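/- arXiv:2410.11717 — 3 statements merged into one kernel-verified Lean document; each statement's English description precedes it below -/
import Mathlib

section
/- Let Φ be a finite based root system. Then (Φ, Φ⁺) has a unique oriented matroid root system structure: if (Φ, α ↦ −α, d) is any OMRS on (Φ, Φ⁺), then d(X) = cone(X) ∩ Φ for every subset X ⊆ Φ, i.e., d coincides with the RRS oriented matroid closure cone_Φ. -/
open Set Pointwise

variable {V : Type*} [AddCommGroup V] [Module ℝ V]

/-- `cone X` is the set of all finite nonnegative linear combinations of elements of `X`. -/
def cone (X : Set V) : Set V :=
  {v | ∃ (n : ℕ) (c : Fin n → ℝ) (x : Fin n → V),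
    (∀ i, 0 ≤ c i) ∧ (∀ i, x i ∈ X) ∧ v = ∑ i, c i • x i}

/-- An oriented matroid structure on the ground set `E ⊆ V`, with involution `x ↦ -x`
and closure operator `d` (only its values on subsets of `E` are relevant). -/
structure IsOrientedMatroidOn (E : Set V) (d : Set V → Set V) : Prop where
  neg_mem : ∀ x ∈ E, -x ∈ E
  neg_ne : ∀ x ∈ E, -x ≠ x
  cx_le_ground : ∀ X, X ⊆ E → d X ⊆ E
  le_cx : ∀ X, X ⊆ E → X ⊆ d X
  cx_mono : ∀ X Y : Set V, X ⊆ Y → Y ⊆ E → d X ⊆ d Y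
  cx_idem : ∀ X, X ⊆ E → d (d X) = d X
  cx_neg : ∀ X, X ⊆ E → d (-X) = -(d X)
  exchange2 : ∀ X, X ⊆ E → ∀ x ∈ E, x ∈ d (X ∪ {-x}) → x ∈ d X
  exchange3 : ∀ X, X ⊆ E → ∀ x ∈ E, ∀ y ∈ E,
    x ∈ d (X ∪ {-y}) → x ∉ d X → y ∈ d ((X \ {y}) ∪ {-x})
  finitary : ∀ X, X ⊆ E → ∀ x ∈ d X, ∃ Y, Y ⊆ X ∧ Y.Finite ∧ x ∈ d Y

/-- The oriented matroid is reduced: `d ∅ = ∅` and `d {x} = {x}` for `x ∈ E`. -/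
def IsReducedOn (E : Set V) (d : Set V → Set V) : Prop :=
  d ∅ = ∅ ∧ ∀ x ∈ E, d {x} = {x}

/-- A tope: a maximal `d`-closed asymmetric subset of `E`. -/
def IsTope (E : Set V) (d : Set V → Set V) (R : Set V) : Prop :=
  R ⊆ E ∧ d R ⊆ R ∧ (∀ x ∈ R, -x ∉ R) ∧
    ∀ R' : Set V, R' ⊆ E → d R' ⊆ R' → (∀ x ∈ R', -x ∉ R') → R ⊆ R' → R' = R

/-- The simple reflections `s_α : v ↦ v - 2B(v,α)α` for `α ∈ Δ`. -/
def simpleReflections (B : LinearMap.BilinForm ℝ V) (Δ : Set V) : Set (V ≃ₗ[ℝ] V) :=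
  {g | ∃ α ∈ Δ, ∀ v : V, g v = v - (2 * B v α) • α}

/-- The Weyl group generated by the simple reflections. -/
def weylGroup (B : LinearMap.BilinForm ℝ V) (Δ : Set V) : Subgroup (V ≃ₗ[ℝ] V) :=
  Subgroup.closure (simpleReflections B Δ)

/-- The root system `Φ = W·Δ`. -/
def rootSystem (B : LinearMap.BilinForm ℝ V) (Δ : Set V) : Set V :=
  {v | ∃ w ∈ weylGroup B Δ, ∃ α ∈ Δ, v = w α}

/-- The positive roots `Φ⁺ = Φ ∩ cone(Δ)`. -/
def positiveRoots (B : LinearMap.BilinForm ℝ V) (Δ : Set V) : Set V :=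
  rootSystem B Δ ∩ cone Δ

/-- A based root system with simple roots `Δ` and symmetric bilinear form `B`. -/
structure IsBasedRootSystem (B : LinearMap.BilinForm ℝ V) (Δ : Set V) : Prop where
  finite : Δ.Finite
  indep : LinearIndependent ℝ ((↑) : Δ → V)
  symm : ∀ u v : V, B u v = B v u
  diag_one : ∀ α ∈ Δ, B α α = 1
  offdiag : ∀ α ∈ Δ, ∀ β ∈ Δ, α ≠ β →
    (∃ m : ℕ, 2 ≤ m ∧ B α β = -Real.cos (Real.pi / (m : ℝ))) ∨ B α β ≤ -1

/-- An oriented matroid root system (OMRS) on `(Φ, Φ⁺)`. -/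
structure IsOMRS (B : LinearMap.BilinForm ℝ V) (Δ : Set V) (d : Set V → Set V) : Prop where
  om : IsOrientedMatroidOn (rootSystem B Δ) d
  reduced : IsReducedOn (rootSystem B Δ) d
  equivariant : ∀ w ∈ weylGroup B Δ, ∀ X, X ⊆ rootSystem B Δ → d (⇑w '' X) = ⇑w '' d X
  positive_closed : d (positiveRoots B Δ) = positiveRoots B Δ
  rank_two : ∀ X, X ⊆ rootSystem B Δ →
    Module.rank ℝ ↥(Submodule.span ℝ X) ≤ 2 → d X = cone X ∩ rootSystem B Δ

/-- `A` is `c₂`-closed in `P`. -/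
def C2Closed (P A : Set V) : Prop :=
  ∀ α ∈ A, ∀ β ∈ A, ∀ γ ∈ P, γ ∈ cone {α, β} → γ ∈ A

/-- `A` is `c₂`-biclosed in `P`. -/
def C2Biclosed (P A : Set V) : Prop :=
  C2Closed P A ∧ C2Closed P (P \ A)

/-- A root system is clean if every `c₂`-biclosed set of positive roots gives a tope of
the RRS oriented matroid `(Φ, -, cone_Φ)`. -/
def IsClean (B : LinearMap.BilinForm ℝ V) (Δ : Set V) : Prop :=
  ∀ A, A ⊆ positiveRoots B Δ → C2Biclosed (positiveRoots B Δ) A →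
    IsTope (rootSystem B Δ) (fun X => cone X ∩ rootSystem B Δ)
      (A ∪ (-(positiveRoots B Δ \ A)))

namespace OMRS

/-! ### Basic facts: reflections, the group, the invariant form -/

/-- Precomposition of a functional with a linear automorphism. -/
def act (f : V →ₗ[ℝ] ℝ) (w : V ≃ₗ[ℝ] V) : V →ₗ[ℝ] ℝ := f ∘ₗ (w : V →ₗ[ℝ] V)

@[simp] lemma act_apply (f : V →ₗ[ℝ] ℝ) (w : V ≃ₗ[ℝ] V) (v : V) : act f w v = f (w v) := rfl

lemma act_mul (f : V →ₗ[ℝ] ℝ) (w w' : V ≃ₗ[ℝ] V) : act f (w * w') = act (act f w) w' := rfl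

lemma act_one (f : V →ₗ[ℝ] ℝ) : act f 1 = f := rfl

open Classical in
/-- The reflection in `α`. -/
noncomputable def sref (B : LinearMap.BilinForm ℝ V) (α : V) : V ≃ₗ[ℝ] V :=
  if h : B α α = 1 then
    Module.reflection (x := α) (f := (2 : ℝ) • B.flip α) (by simp [h])
  else 1

lemma sref_apply (B : LinearMap.BilinForm ℝ V) (α : V) (h : B α α = 1) (v : V) :
    sref B α v = v - (2 * B v α) • α := by
  simp [sref, h, Module.reflection_apply]

section
variable {B : LinearMap.BilinForm ℝ V} {Δ : Set V} (hb : IsBasedRootSystem B Δ)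
include hb

lemma s_apply {α : V} (hα : α ∈ Δ) (v : V) : sref B α v = v - (2 * B v α) • α :=
  sref_apply B α (hb.diag_one α hα) v

lemma s_mem {α : V} (hα : α ∈ Δ) : sref B α ∈ weylGroup B Δ :=
  Subgroup.subset_closure ⟨α, hα, s_apply hb hα⟩

lemma s_self {α : V} (hα : α ∈ Δ) : sref B α α = -α := by
  rw [s_apply hb hα, hb.diag_one α hα, mul_one, two_smul]; abel

lemma s_s {α : V} (hα : α ∈ Δ) (v : V) : sref B α (sref B α v) = v := by
  rw [s_apply hb hα, s_apply hb hα]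
  simp only [map_sub, map_smul, LinearMap.sub_apply, LinearMap.smul_apply, smul_eq_mul,
    hb.diag_one α hα]
  module

lemma B_inv {w : V ≃ₗ[ℝ] V} (hw : w ∈ weylGroup B Δ) : ∀ u v : V, B (w u) (w v) = B u v := by
  induction hw using Subgroup.closure_induction with
  | mem g hg =>
    obtain ⟨α, hα, hg⟩ := hg
    intro u v
    simp only [hg, map_sub, map_smul, LinearMap.sub_apply, LinearMap.smul_apply, smul_eq_mul,
      hb.diag_one α hα, hb.symm α v]
    ring
  | one => intro u v; rfl
  | mul x y _ _ hx hy => intro u v; rw [LinearEquiv.mul_apply, LinearEquiv.mul_apply, hx, hy]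
  | inv x _ hx =>
    intro u v
    have := hx (x⁻¹ u) (x⁻¹ v)
    rw [← LinearEquiv.mul_apply, ← LinearEquiv.mul_apply, mul_inv_cancel] at this
    exact this.symm

omit hb in
lemma root_w {w : V ≃ₗ[ℝ] V} (hw : w ∈ weylGroup B Δ) {β : V} (hβ : β ∈ rootSystem B Δ) :
    w β ∈ rootSystem B Δ := by
  obtain ⟨w', hw', α, hα, rfl⟩ := hβ
  exact ⟨w * w', mul_mem hw hw', α, hα, rfl⟩

omit hb in
lemma simple_root {α : V} (hα : α ∈ Δ) : α ∈ rootSystem B Δ :=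
  ⟨1, one_mem _, α, hα, rfl⟩

lemma root_norm {β : V} (hβ : β ∈ rootSystem B Δ) : B β β = 1 := by
  obtain ⟨w', hw', α, hα, rfl⟩ := hβ
  rw [B_inv hb hw', hb.diag_one α hα]

lemma root_neg {β : V} (hβ : β ∈ rootSystem B Δ) : -β ∈ rootSystem B Δ := by
  obtain ⟨w', hw', α, hα, rfl⟩ := hβ
  refine ⟨w' * sref B α, mul_mem hw' (s_mem hb hα), α, hα, ?_⟩
  rw [LinearEquiv.mul_apply, s_self hb hα, map_neg]

lemma root_ne_zero {β : V} (hβ : β ∈ rootSystem B Δ) : β ≠ 0 := by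
  intro h
  have := root_norm hb hβ
  simp [h] at this

/-- Reflection in an arbitrary root belongs to the group. -/
lemma exists_refl {β : V} (hβ : β ∈ rootSystem B Δ) :
    ∃ s ∈ weylGroup B Δ, ∀ v, s v = v - (2 * B v β) • β := by
  obtain ⟨w, hw, α, hα, rfl⟩ := hβ
  refine ⟨w * sref B α * w⁻¹, mul_mem (mul_mem hw (s_mem hb hα)) (inv_mem hw), fun v => ?_⟩
  have h1 : w (w⁻¹ v) = v := by rw [← LinearEquiv.mul_apply, mul_inv_cancel]; rfl
  rw [LinearEquiv.mul_apply, LinearEquiv.mul_apply, s_apply hb hα, map_sub, map_smul, h1]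
  congr 3
  rw [← B_inv hb hw, h1]

lemma exists_functional (c : V → ℝ) : ∃ f : V →ₗ[ℝ] ℝ, ∀ α ∈ Δ, f α = c α := by
  have hli : LinearIndepOn ℝ id Δ := hb.indep
  let b := Module.Basis.extend hli
  refine ⟨b.constr ℝ (fun i => c i), fun α hα => ?_⟩
  have h : b ⟨α, hli.subset_extend (Set.subset_univ _) hα⟩ = α := by simp [b, Module.Basis.extend_apply_self]
  conv_lhs => rw [← h]
  rw [Module.Basis.constr_basis]

omit hb in
lemma w_sub_mem_span {w : V ≃ₗ[ℝ] V} (hw : w ∈ weylGroup B Δ) :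
    ∀ v ∈ Submodule.span ℝ Δ, w v ∈ Submodule.span ℝ Δ := by
  have : ∀ w ∈ weylGroup B Δ, ∀ v, w v - v ∈ Submodule.span ℝ Δ := by
    intro w hw
    induction hw using Subgroup.closure_induction with
    | mem g hg =>
      obtain ⟨α, hα, hg⟩ := hg
      intro v
      rw [hg]
      have := Submodule.smul_mem _ (-(2 * B v α)) (Submodule.subset_span (R := ℝ) hα)
      convert this using 1
      module
    | one => intro v; simp
    | mul x y _ _ hx hy =>
      intro v
      have := add_mem (hx (y v)) (hy v)
      simpa using this
    | inv x _ hx =>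
      intro v
      have := neg_mem (hx (x⁻¹ v))
      rw [← LinearEquiv.mul_apply, mul_inv_cancel] at this
      simpa using this
  intro v hv
  have := add_mem (this w hw v) hv
  simpa using this

omit hb in
lemma root_span {β : V} (hβ : β ∈ rootSystem B Δ) : β ∈ Submodule.span ℝ Δ := by
  obtain ⟨w', hw', α, hα, rfl⟩ := hβ
  exact w_sub_mem_span hw' α (Submodule.subset_span hα)

end

/-- Invariant form on functionals. -/
noncomputable def Q {Φ : Set V} (hfin : Φ.Finite) (f g : V →ₗ[ℝ] ℝ) : ℝ :=
  ∑ β ∈ hfin.toFinset, f β * g β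

section
variable {B : LinearMap.BilinForm ℝ V} {Δ : Set V} (hb : IsBasedRootSystem B Δ)
  (hfin : (rootSystem B Δ).Finite)

lemma Q_inv {w : V ≃ₗ[ℝ] V} (hw : w ∈ weylGroup B Δ) (f g : V →ₗ[ℝ] ℝ) :
    Q hfin (act f w) (act g w) = Q hfin f g := by
  unfold Q
  refine Finset.sum_nbij' (fun v => w v) (fun v => w⁻¹ v) ?_ ?_ ?_ ?_ ?_
  · intro a ha; simpa using root_w hw (by simpa using ha)
  · intro a ha; simpa using root_w (inv_mem hw) (by simpa using ha)
  · intro a _; simp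
  · intro a _; simp
  · intro a _; simp

include hb in
lemma Q_refl {α : V} (hα : α ∈ Δ) (f : V →ₗ[ℝ] ℝ) :
    Q hfin (B.flip α) f = f α * Q hfin (B.flip α) (B.flip α) := by
  have h := Q_inv hfin (s_mem hb hα) (B.flip α) f
  have e : Q hfin (act (B.flip α) (sref B α)) (act f (sref B α))
      = -Q hfin (B.flip α) f + 2 * f α * Q hfin (B.flip α) (B.flip α) := by
    unfold Q
    rw [Finset.mul_sum, ← Finset.sum_neg_distrib, ← Finset.sum_add_distrib]
    refine Finset.sum_congr rfl fun v _ => ?_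
    simp only [act_apply, s_apply hb hα, map_sub, map_smul, LinearMap.sub_apply,
      LinearMap.smul_apply, smul_eq_mul, LinearMap.BilinForm.flip_apply, hb.diag_one α hα]
    ring
  rw [e] at h
  linarith

lemma Q_nonneg (f : V →ₗ[ℝ] ℝ) : 0 ≤ Q hfin f f :=
  Finset.sum_nonneg fun _ _ => mul_self_nonneg _

include hb in
lemma Q_pos {α : V} (hα : α ∈ Δ) : 0 < Q hfin (B.flip α) (B.flip α) := by
  refine Finset.sum_pos' (fun _ _ => mul_self_nonneg _) ⟨α, ?_, ?_⟩
  · simpa using simple_root hα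
  · simp [hb.diag_one α hα]

include hb in
lemma Q_step {α : V} (hα : α ∈ Δ) {f f0 : V →ₗ[ℝ] ℝ} (h0 : 0 < f0 α) (hf : f α < 0) :
    Q hfin f f0 < Q hfin (act f (sref B α)) f0 := by
  have e : Q hfin (act f (sref B α)) f0 = Q hfin f f0 - 2 * f α * Q hfin (B.flip α) f0 := by
    unfold Q
    rw [Finset.mul_sum, ← Finset.sum_sub_distrib]
    refine Finset.sum_congr rfl fun v _ => ?_
    simp only [act_apply, s_apply hb hα, map_sub, map_smul, smul_eq_mul, LinearMap.BilinForm.flip_apply]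
    ring
  rw [e, Q_refl hb hfin hα]
  have := mul_pos (mul_pos (neg_pos.2 hf) h0) (Q_pos hb hfin hα)
  nlinarith

/-- A maximum principle over the group. -/
lemma max_principle (f f0 : V →ₗ[ℝ] ℝ) (P : (V ≃ₗ[ℝ] V) → Prop)
    (hex : ∃ w ∈ weylGroup B Δ, P w) :
    ∃ w ∈ weylGroup B Δ, P w ∧ ∀ w' ∈ weylGroup B Δ, P w' →
      Q hfin (act f w') f0 ≤ Q hfin (act f w) f0 := by
  classical
  let S : Set (V ≃ₗ[ℝ] V) := {w | w ∈ weylGroup B Δ ∧ P w}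
  have : Finite (rootSystem B Δ) := hfin
  have hT : ((fun w => Q hfin (act f w) f0) '' S).Finite := by
    let F : (rootSystem B Δ → rootSystem B Δ) → ℝ := fun σ =>
      ∑ β ∈ hfin.toFinset.attach, f (σ ⟨β.1, hfin.mem_toFinset.1 β.2⟩) * f0 β.1
    refine (Set.finite_range F).subset ?_
    rintro _ ⟨w, hw, rfl⟩
    refine ⟨fun β => ⟨w β, root_w hw.1 β.2⟩, ?_⟩
    simp only [F, Q, act_apply]
    exact Finset.sum_attach hfin.toFinset (fun β => f (w β) * f0 β)
  obtain ⟨w0, hw0, hP0⟩ := hex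
  obtain ⟨t, ⟨w, hw, rfl⟩, ht⟩ := Set.exists_max_image _ id hT ⟨_, ⟨w0, ⟨hw0, hP0⟩, rfl⟩⟩
  exact ⟨w, hw.1, hw.2, fun w' hw' hP => ht _ ⟨w', ⟨hw', hP⟩, rfl⟩⟩

/-- Nonnegative on the simple roots. -/
def Dom (Δ : Set V) (f : V →ₗ[ℝ] ℝ) : Prop := ∀ α ∈ Δ, 0 ≤ f α

/-- An ascending step. -/
def Step (B : LinearMap.BilinForm ℝ V) (Δ : Set V) (f g : V →ₗ[ℝ] ℝ) : Prop :=
  ∃ α ∈ Δ, f α < 0 ∧ g = act f (sref B α)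

end

/-! ### Dihedral computations and uniqueness of dominant representatives -/

/-- Alternating sequence `a, b, a, b, …`. -/
def alt (a b : V) : ℕ → V
  | 0 => a
  | k + 1 => alt b a k

lemma alt_add_two (a b : V) (k : ℕ) : alt a b (k + 2) = alt a b k := rfl

lemma alt_succ (a b : V) (k : ℕ) : alt a b (k + 1) = alt b a k := rfl

lemma alt_cases (a b : V) (k : ℕ) :
    (alt a b k = a ∧ alt b a k = b) ∨ (alt a b k = b ∧ alt b a k = a) := by
  induction k generalizing a b with
  | zero => exact Or.inl ⟨rfl, rfl⟩
  | succ k ih =>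
    rcases ih b a with h | h
    · exact Or.inr h
    · exact Or.inl h

/-- Alternating words. -/
noncomputable def word (B : LinearMap.BilinForm ℝ V) (a b : V) : ℕ → (V ≃ₗ[ℝ] V)
  | 0 => 1
  | k + 1 => word B a b k * sref B (alt a b k)

section
variable {B : LinearMap.BilinForm ℝ V} {Δ : Set V} (hb : IsBasedRootSystem B Δ)

lemma alt_mem {a b : V} (ha : a ∈ Δ) (hb' : b ∈ Δ) (k : ℕ) : alt a b k ∈ Δ := by
  rcases alt_cases a b k with h | h <;> rw [h.1] <;> assumption

include hb in
lemma word_mem {a b : V} (ha : a ∈ Δ) (hb' : b ∈ Δ) (k : ℕ) : word B a b k ∈ weylGroup B Δ := by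
  induction k with
  | zero => exact one_mem _
  | succ k ih => exact mul_mem ih (s_mem hb (alt_mem ha hb' k))

include hb in
lemma word_formula {a b : V} (ha : a ∈ Δ) (hb' : b ∈ Δ) {θ : ℝ} (hθ : B a b = -Real.cos θ)
    (k : ℕ) :
    Real.sin θ • word B a b k (alt a b k)
        = Real.sin ((k + 1 : ℝ) * θ) • a + Real.sin (k * θ) • b ∧
    Real.sin θ • word B a b k (alt a b (k + 1))
        = -(Real.sin (k * θ) • a + Real.sin ((k - 1 : ℝ) * θ) • b) := by
  induction k with
  | zero => simp [word, alt]
  | succ k ih =>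
    obtain ⟨h1, h2⟩ := ih
    have hB : B (alt a b (k + 1)) (alt a b k) = -Real.cos θ := by
      rcases alt_cases a b k with h | h
      · rw [alt_succ, h.1, h.2, hb.symm, hθ]
      · rw [alt_succ, h.1, h.2, hθ]
    have r1 : Real.sin (((k + 1 : ℕ) + 1 : ℝ) * θ)
        = 2 * Real.cos θ * Real.sin ((k + 1 : ℝ) * θ) - Real.sin (k * θ) := by
      have e1 : ((k + 1 : ℕ) + 1 : ℝ) * θ = (k + 1 : ℝ) * θ + θ := by push_cast; ring
      have e2 : (k : ℝ) * θ = (k + 1 : ℝ) * θ - θ := by ring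
      rw [e1, e2, Real.sin_add, Real.sin_sub]; ring
    have r2 : Real.sin (((k + 1 : ℕ) : ℝ) * θ)
        = 2 * Real.cos θ * Real.sin (k * θ) - Real.sin ((k - 1 : ℝ) * θ) := by
      have e1 : ((k + 1 : ℕ) : ℝ) * θ = k * θ + θ := by push_cast; ring
      have e2 : (k - 1 : ℝ) * θ = k * θ - θ := by ring
      rw [e1, e2, Real.sin_add, Real.sin_sub]; ring
    constructor
    · rw [word, LinearEquiv.mul_apply, s_apply hb (alt_mem ha hb' k), hB, map_sub, map_smul,
        smul_sub, smul_comm, h1, h2, r1, r2]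
      module
    · rw [alt_add_two, word, LinearEquiv.mul_apply, s_self hb (alt_mem ha hb' k), map_neg,
        smul_neg, h1]
      push_cast
      congr 4
      ring

include hb in
lemma word_sub {a b : V} (ha : a ∈ Δ) (hb' : b ∈ Δ) (k : ℕ) (v : V) :
    ∃ x y : ℝ, word B a b k v = v + x • a + y • b := by
  induction k generalizing v with
  | zero => exact ⟨0, 0, by simp [word]⟩
  | succ k ih =>
    rw [word, LinearEquiv.mul_apply, s_apply hb (alt_mem ha hb' k)]
    obtain ⟨x, y, h⟩ := ih (v - (2 * B v (alt a b k)) • alt a b k)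
    rw [h]
    rcases alt_cases a b k with h | h
    · rw [h.1]
      exact ⟨x - 2 * B v a, y, by module⟩
    · rw [h.1]
      exact ⟨x, y - 2 * B v b, by module⟩

include hb in
lemma word_eq {a b : V} (ha : a ∈ Δ) (hb' : b ∈ Δ) {m : ℕ} (hm : 2 ≤ m)
    (hθ : B a b = -Real.cos (Real.pi / m)) (v : V) : word B a b m v = word B b a m v := by
  set θ := Real.pi / (m : ℝ) with hθd
  have hm0 : (0 : ℝ) < m := by positivity
  have hmθ : (m : ℝ) * θ = Real.pi := by rw [hθd]; field_simp
  have hsin : 0 < Real.sin θ := by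
    apply Real.sin_pos_of_pos_of_lt_pi
    · positivity
    · rw [hθd]
      apply div_lt_self Real.pi_pos
      exact_mod_cast (by omega : 1 < m)
  have key : ∀ {a b : V}, a ∈ Δ → b ∈ Δ → B a b = -Real.cos θ →
      word B a b m (alt a b m) = -a ∧ word B a b m (alt b a m) = -b := by
    intro a b ha hb' hab
    obtain ⟨h1, h2⟩ := word_formula hb ha hb' hab m
    have e1 : Real.sin ((m + 1 : ℝ) * θ) = - Real.sin θ := by
      rw [add_mul, hmθ, one_mul, add_comm, Real.sin_add_pi]
    have e2 : Real.sin ((m - 1 : ℝ) * θ) = Real.sin θ := by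
      rw [sub_mul, hmθ, one_mul, Real.sin_pi_sub]
    rw [e1, hmθ, Real.sin_pi, zero_smul, add_zero, neg_smul, ← smul_neg] at h1
    rw [e2, hmθ, Real.sin_pi, zero_smul, zero_add, ← smul_neg, alt_succ] at h2
    exact ⟨smul_right_injective V hsin.ne' h1, smul_right_injective V hsin.ne' h2⟩
  have hba : B b a = -Real.cos θ := by rw [hb.symm, hθ]
  obtain ⟨k1, k2⟩ := key ha hb' hθ
  obtain ⟨k3, k4⟩ := key hb' ha hba
  have i1 := B_inv hb (word_mem hb ha hb' m) v
  have i2 := B_inv hb (word_mem hb hb' ha m) v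
  have ea : B (word B a b m v) a = B (word B b a m v) a := by
    have := i1 (alt a b m)
    have := i2 (alt a b m)
    rw [k1] at *
    rw [k4] at *
    simp only [map_neg] at *
    linarith
  have eb : B (word B a b m v) b = B (word B b a m v) b := by
    have := i1 (alt b a m)
    have := i2 (alt b a m)
    rw [k2] at *
    rw [k3] at *
    simp only [map_neg] at *
    linarith
  obtain ⟨x, y, h⟩ := word_sub hb ha hb' m v
  obtain ⟨y', x', h'⟩ := word_sub hb hb' ha m v
  rw [h, h'] at ea eb
  simp only [map_add, map_smul, LinearMap.add_apply, LinearMap.smul_apply, smul_eq_mul,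
    hb.diag_one a ha, hb.diag_one b hb', hθ, hba] at ea eb
  have hs2 : Real.sin θ ^ 2 = 1 - Real.cos θ ^ 2 := Real.sin_sq θ
  have hne : Real.sin θ ^ 2 ≠ 0 := by positivity
  have hx : x = x' := by
    have : Real.sin θ ^ 2 * (x - x') = 0 := by
      rw [hs2]; linear_combination ea + Real.cos θ * eb
    rcases mul_eq_zero.1 this with h | h
    · exact absurd h hne
    · linarith
  have hy : y = y' := by rw [hx] at eb; linarith
  rw [h, h', hx, hy]
  abel

include hb in
lemma B_gt_neg_one (hfin : (rootSystem B Δ).Finite) {a b : V} (ha : a ∈ Δ) (hb' : b ∈ Δ)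
    (h : B a b ≤ -1) : False := by
  obtain ⟨f0, hf0⟩ := exists_functional hb (fun _ => 1)
  have q1 := Q_refl hb hfin ha (B.flip b)
  have q2 := Q_refl hb hfin hb' (B.flip a)
  have qa := Q_pos hb hfin ha
  have qb := Q_pos hb hfin hb'
  have comm : Q hfin (B.flip b) (B.flip a) = Q hfin (B.flip a) (B.flip b) := by
    unfold Q; exact Finset.sum_congr rfl fun _ _ => mul_comm _ _
  simp only [LinearMap.BilinForm.flip_apply] at q1 q2
  rw [hb.symm b a] at q2
  have hN : Q hfin (B.flip a) (B.flip a) = Q hfin (B.flip b) (B.flip b) := by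
    have : B a b * Q hfin (B.flip a) (B.flip a) = B a b * Q hfin (B.flip b) (B.flip b) := by
      rw [← q1, ← q2, comm]
    exact mul_left_cancel₀ (by linarith) this
  have hexp : Q hfin (B.flip a + B.flip b) (B.flip a + B.flip b) ≤ 0 := by
    have : Q hfin (B.flip a + B.flip b) (B.flip a + B.flip b)
        = Q hfin (B.flip a) (B.flip a) + 2 * Q hfin (B.flip a) (B.flip b)
          + Q hfin (B.flip b) (B.flip b) := by
      unfold Q
      rw [Finset.mul_sum, ← Finset.sum_add_distrib, ← Finset.sum_add_distrib]
      refine Finset.sum_congr rfl fun v _ => ?_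
      simp only [LinearMap.add_apply]; ring
    rw [this, q1]
    nlinarith
  have hz : ∀ β ∈ hfin.toFinset, (B.flip a + B.flip b) β * (B.flip a + B.flip b) β = 0 := by
    have h0 : Q hfin (B.flip a + B.flip b) (B.flip a + B.flip b) = 0 :=
      le_antisymm hexp (Q_nonneg hfin _)
    exact (Finset.sum_eq_zero_iff_of_nonneg (fun _ _ => mul_self_nonneg _)).1 h0
  have h1 : Q hfin (B.flip a) f0 + Q hfin (B.flip b) f0 = 0 := by
    unfold Q
    rw [← Finset.sum_add_distrib]
    refine Finset.sum_eq_zero fun v hv => ?_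
    have := mul_self_eq_zero.1 (hz v hv)
    rw [← add_mul]
    rw [LinearMap.add_apply] at this
    rw [this, zero_mul]
  rw [Q_refl hb hfin ha, Q_refl hb hfin hb', hf0 a ha, hf0 b hb'] at h1
  linarith

include hb in
lemma word_steps {a b : V} (ha : a ∈ Δ) (hb' : b ∈ Δ) {m : ℕ} (hm : 2 ≤ m)
    (hθ : B a b = -Real.cos (Real.pi / m)) {f : V →ₗ[ℝ] ℝ} (fa : f a < 0) (fb : f b < 0) :
    Relation.ReflTransGen (Step B Δ) (act f (sref B a)) (act f (word B a b m)) := by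
  set θ := Real.pi / (m : ℝ) with hθd
  have hm0 : (0 : ℝ) < m := by positivity
  have hmθ : (m : ℝ) * θ = Real.pi := by rw [hθd]; field_simp
  have hθ0 : 0 < θ := by positivity
  have hsin : 0 < Real.sin θ := by
    apply Real.sin_pos_of_pos_of_lt_pi hθ0
    rw [hθd]
    apply div_lt_self Real.pi_pos
    exact_mod_cast (by omega : 1 < m)
  have main : ∀ k : ℕ, k + 1 ≤ m →
      Relation.ReflTransGen (Step B Δ) (act f (sref B a)) (act f (word B a b (k + 1))) := by
    intro k
    induction k with
    | zero => intro _; simp only [word, alt, one_mul]; exact .refl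
    | succ k ih =>
      intro hk
      refine (ih (by omega)).tail ⟨alt a b (k + 1), alt_mem ha hb' _, ?_, ?_⟩
      · obtain ⟨h1, -⟩ := word_formula hb ha hb' hθ (k + 1)
        have h2 := congrArg f h1
        simp only [map_add, map_smul, smul_eq_mul] at h2
        rw [act_apply]
        have p1 : 0 < Real.sin (((k + 1 : ℕ) : ℝ) * θ) := by
          apply Real.sin_pos_of_pos_of_lt_pi
          · positivity
          · rw [← hmθ]
            apply mul_lt_mul_of_pos_right _ hθ0
            exact_mod_cast hk
        have p2 : 0 ≤ Real.sin ((((k + 1 : ℕ) : ℝ) + 1) * θ) := by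
          apply Real.sin_nonneg_of_nonneg_of_le_pi
          · positivity
          · rw [← hmθ]
            apply mul_le_mul_of_nonneg_right _ hθ0.le
            exact_mod_cast hk
        by_contra hcon
        have := mul_nonneg hsin.le (not_lt.1 hcon)
        rw [h2] at this
        nlinarith
      · rfl
  have := main (m - 1) (by omega)
  rwa [Nat.sub_add_cancel (by omega)] at this

include hb in
lemma local_confl (hfin : (rootSystem B Δ).Finite) {a b : V} (ha : a ∈ Δ) (hb' : b ∈ Δ)
    {f : V →ₗ[ℝ] ℝ} (fa : f a < 0) (fb : f b < 0) :
    ∃ w ∈ weylGroup B Δ, Relation.ReflTransGen (Step B Δ) (act f (sref B a)) (act f w) ∧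
      Relation.ReflTransGen (Step B Δ) (act f (sref B b)) (act f w) := by
  by_cases hab : a = b
  · subst hab
    exact ⟨sref B a, s_mem hb ha, .refl, .refl⟩
  rcases hb.offdiag a ha b hb' hab with ⟨m, hm, h⟩ | h
  · refine ⟨word B a b m, word_mem hb ha hb' m, word_steps hb ha hb' hm h fa fb, ?_⟩
    have e : act f (word B a b m) = act f (word B b a m) := by
      ext v
      rw [act_apply, act_apply, word_eq hb ha hb' hm h]
    rw [e]
    exact word_steps hb hb' ha hm (by rw [hb.symm, h]) fb fa
  · exact (B_gt_neg_one hb hfin ha hb' h).elim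

include hb in
lemma reach_act {f g : V →ₗ[ℝ] ℝ} (h : Relation.ReflTransGen (Step B Δ) f g) :
    ∃ w ∈ weylGroup B Δ, g = act f w := by
  induction h with
  | refl => exact ⟨1, one_mem _, rfl⟩
  | tail _ h ih =>
    obtain ⟨w, hw, rfl⟩ := ih
    obtain ⟨α, hα, _, rfl⟩ := h
    exact ⟨w * sref B α, mul_mem hw (s_mem hb hα), rfl⟩

include hb in
lemma exists_dom_reach (hfin : (rootSystem B Δ).Finite) (f : V →ₗ[ℝ] ℝ) :
    ∃ w ∈ weylGroup B Δ, Relation.ReflTransGen (Step B Δ) f (act f w) ∧ Dom Δ (act f w) := by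
  obtain ⟨f0, hf0⟩ := exists_functional hb (fun _ => 1)
  obtain ⟨w, hw, hP, hmax⟩ := max_principle hfin f f0
    (fun w => Relation.ReflTransGen (Step B Δ) f (act f w)) ⟨1, one_mem _, .refl⟩
  refine ⟨w, hw, hP, fun α hα => ?_⟩
  by_contra hneg
  rw [not_le] at hneg
  have h1 := Q_step hb hfin hα (f0 := f0) (by rw [hf0 α hα]; norm_num) hneg
  have h2 := hmax (w * sref B α) (mul_mem hw (s_mem hb hα)) (hP.tail ⟨α, hα, hneg, rfl⟩)
  rw [act_mul] at h2
  linarith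

include hb in
lemma reach_unique (hfin : (rootSystem B Δ).Finite) (f : V →ₗ[ℝ] ℝ) {g1 g2 : V →ₗ[ℝ] ℝ}
    (h1 : Relation.ReflTransGen (Step B Δ) f g1) (h2 : Relation.ReflTransGen (Step B Δ) f g2)
    (d1 : Dom Δ g1) (d2 : Dom Δ g2) : g1 = g2 := by
  by_contra hne
  obtain ⟨f0, hf0⟩ := exists_functional hb (fun _ => 1)
  obtain ⟨w, hw, ⟨g1, g2, h1, h2, d1, d2, hne⟩, hmax⟩ := max_principle hfin f f0
    (fun w => ∃ g1 g2, Relation.ReflTransGen (Step B Δ) (act f w) g1 ∧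
      Relation.ReflTransGen (Step B Δ) (act f w) g2 ∧ Dom Δ g1 ∧ Dom Δ g2 ∧ g1 ≠ g2)
    ⟨1, one_mem _, g1, g2, h1, h2, d1, d2, hne⟩
  have uniq : ∀ α ∈ Δ, act f w α < 0 → ∀ k1 k2,
      Relation.ReflTransGen (Step B Δ) (act (act f w) (sref B α)) k1 →
      Relation.ReflTransGen (Step B Δ) (act (act f w) (sref B α)) k2 →
      Dom Δ k1 → Dom Δ k2 → k1 = k2 := by
    intro α hα hneg k1 k2 r1 r2 e1 e2
    by_contra hk
    have s1 := Q_step hb hfin hα (f0 := f0) (by rw [hf0 α hα]; norm_num) hneg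
    have s2 := hmax (w * sref B α) (mul_mem hw (s_mem hb hα)) ⟨k1, k2, r1, r2, e1, e2, hk⟩
    rw [act_mul] at s2
    linarith
  rcases Relation.ReflTransGen.cases_head h1 with h | ⟨k1, ⟨α, hα, ha, rfl⟩, r1⟩
  · rcases Relation.ReflTransGen.cases_head h2 with h' | ⟨k2, ⟨β, hβ, hb2, rfl⟩, r2⟩
    · exact hne (h.symm.trans h')
    · have := d1 β hβ
      rw [← h] at this
      linarith
  · rcases Relation.ReflTransGen.cases_head h2 with h' | ⟨k2, ⟨β, hβ, hb2, rfl⟩, r2⟩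
    · have := d2 α hα
      rw [← h'] at this
      linarith
    · obtain ⟨u, hu, c1, c2⟩ := local_confl hb hfin hα hβ ha hb2
      obtain ⟨u', hu', c3, c4⟩ := exists_dom_reach hb hfin (act (act f w) u)
      exact hne ((uniq α hα ha _ _ r1 (c1.trans c3) d1 c4).trans
        (uniq β hβ hb2 _ _ r2 (c2.trans c3) d2 c4).symm)

include hb in
lemma reach_orbit (hfin : (rootSystem B Δ).Finite) {w : V ≃ₗ[ℝ] V} (hw : w ∈ weylGroup B Δ) :
    ∀ (f g1 g2 : V →ₗ[ℝ] ℝ), Relation.ReflTransGen (Step B Δ) f g1 →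
      Relation.ReflTransGen (Step B Δ) (act f w) g2 → Dom Δ g1 → Dom Δ g2 → g1 = g2 := by
  induction hw using Subgroup.closure_induction with
  | mem g hg =>
    obtain ⟨α, hα, hg⟩ := hg
    have : g = sref B α := by
      ext v; rw [hg, s_apply hb hα]
    subst this
    intro f g1 g2 h1 h2 d1 d2
    rcases lt_trichotomy (f α) 0 with h | h | h
    · exact reach_unique hb hfin f h1 (.head ⟨α, hα, h, rfl⟩ h2) d1 d2
    · have : act f (sref B α) = f := by
        ext v; simp [s_apply hb hα, h]
      rw [this] at h2
      exact reach_unique hb hfin f h1 h2 d1 d2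
    · refine reach_unique hb hfin _ (.head ⟨α, hα, ?_, ?_⟩ h1) h2 d1 d2
      · rw [act_apply, s_self hb hα, map_neg]; linarith
      · ext v; simp [s_s hb hα]
  | one => intro f g1 g2 h1 h2 d1 d2; exact reach_unique hb hfin f h1 h2 d1 d2
  | mul x y _ _ hx hy =>
    intro f g1 g2 h1 h2 d1 d2
    obtain ⟨u, _, r, du⟩ := exists_dom_reach hb hfin (act f x)
    exact (hx f g1 _ h1 r d1 du).trans (hy (act f x) _ g2 r h2 du d2)
  | inv x _ hx =>
    intro f g1 g2 h1 h2 d1 d2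
    refine (hx (act f x⁻¹) g2 g1 h2 ?_ d2 d1).symm
    rw [← act_mul, inv_mul_cancel, act_one]
    exact h1

include hb in
lemma dom_unique (hfin : (rootSystem B Δ).Finite) {w : V ≃ₗ[ℝ] V} (hw : w ∈ weylGroup B Δ)
    {f : V →ₗ[ℝ] ℝ} (d1 : Dom Δ f) (d2 : Dom Δ (act f w)) : f = act f w :=
  reach_orbit hb hfin hw f _ _ .refl .refl d1 d2

end

/-! ### Cones, the Farkas lemma, coordinates and signs of roots -/

lemma cone_sum {ι : Type*} (s : Finset ι) (c : ι → ℝ) (x : ι → V) {X : Set V}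
    (hc : ∀ i ∈ s, 0 ≤ c i) (hx : ∀ i ∈ s, x i ∈ X) : ∑ i ∈ s, c i • x i ∈ cone X := by
  refine ⟨s.card, fun j => c (s.equivFin.symm j), fun j => x (s.equivFin.symm j),
    fun j => hc _ (s.equivFin.symm j).2, fun j => hx _ (s.equivFin.symm j).2, ?_⟩
  rw [← Finset.sum_coe_sort s (fun i => c i • x i)]
  exact (Equiv.sum_comp s.equivFin.symm (fun i : s => c i • x i)).symm

lemma cone_mem_iff {X : Set V} {v : V} (hv : v ∈ cone X) :
    ∃ (s : Finset V) (c : V → ℝ), (↑s ⊆ X) ∧ (∀ y ∈ s, 0 ≤ c y) ∧ v = ∑ y ∈ s, c y • y := by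
  classical
  obtain ⟨n, c, x, hc, hx, rfl⟩ := hv
  refine ⟨Finset.univ.image x, fun y => ∑ i with x i = y, c i, ?_, ?_, ?_⟩
  · intro y hy
    simp only [Finset.coe_image, Finset.coe_univ, Set.image_univ, Set.mem_range] at hy
    obtain ⟨i, rfl⟩ := hy
    exact hx i
  · intro y _
    exact Finset.sum_nonneg fun i _ => hc i
  · rw [← Finset.sum_fiberwise_of_maps_to (s := Finset.univ) (t := Finset.univ.image x) (g := x)
      (fun i _ => Finset.mem_image_of_mem x (Finset.mem_univ i))]
    refine Finset.sum_congr rfl fun y _ => ?_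
    rw [Finset.sum_smul]
    refine Finset.sum_congr rfl fun i hi => ?_
    rw [(Finset.mem_filter.1 hi).2]

lemma cone_nonneg {X : Set V} {f : V →ₗ[ℝ] ℝ} (hf : ∀ x ∈ X, 0 ≤ f x) {v : V}
    (hv : v ∈ cone X) : 0 ≤ f v := by
  obtain ⟨n, c, x, hc, hx, rfl⟩ := hv
  rw [map_sum]
  refine Finset.sum_nonneg fun i _ => ?_
  rw [map_smul, smul_eq_mul]
  exact mul_nonneg (hc i) (hf _ (hx i))

lemma cone_mono {X Y : Set V} (h : X ⊆ Y) : cone X ⊆ cone Y := by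
  rintro _ ⟨n, c, x, hc, hx, rfl⟩
  exact ⟨n, c, x, hc, fun i => h (hx i), rfl⟩

lemma farkas {ι : Type*} (s : Finset ι) : ∀ (a : ι → V) (b : V),
    (∃ c : ι → ℝ, (∀ i ∈ s, 0 ≤ c i) ∧ b = ∑ i ∈ s, c i • a i) ∨
    ∃ f : V →ₗ[ℝ] ℝ, (∀ i ∈ s, 0 ≤ f (a i)) ∧ f b < 0 := by
  classical
  induction s using Finset.induction_on with
  | empty =>
    intro a b
    by_cases hb : b = 0
    · exact Or.inl ⟨0, by simp, by simp [hb]⟩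
    · right
      have : ∃ f : V →ₗ[ℝ] ℝ, f b ≠ 0 := by
        by_contra hcon
        push Not at hcon
        exact hb ((Module.forall_dual_apply_eq_zero_iff ℝ b).1 hcon)
      obtain ⟨f, hf⟩ := this
      rcases lt_or_gt_of_ne hf with h | h
      · exact ⟨f, by simp, h⟩
      · exact ⟨-f, by simp, by simpa using h⟩
  | insert j s hj ih =>
    intro a b
    rcases ih a b with ⟨c, hc, h⟩ | ⟨f, hf, hfb⟩
    · left
      refine ⟨fun i => if i = j then 0 else c i, ?_, ?_⟩
      · intro i hi
        dsimp only
        split_ifs with h'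
        · exact le_rfl
        · exact hc i ((Finset.mem_insert.1 hi).resolve_left h')
      · rw [Finset.sum_insert hj, h]
        simp only [if_true, zero_smul, zero_add]
        refine Finset.sum_congr rfl fun i hi => ?_
        rw [if_neg (fun (h' : i = j) => hj (h' ▸ hi))]
    · rcases le_or_gt 0 (f (a j)) with h | h
      · right
        refine ⟨f, fun i hi => ?_, hfb⟩
        rcases Finset.mem_insert.1 hi with rfl | h'
        · exact h
        · exact hf i h'
      · let π : V →ₗ[ℝ] V := LinearMap.id - (LinearMap.toSpanSingleton ℝ V ((f (a j))⁻¹ • a j)) ∘ₗ f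
        have hπ : ∀ v, π v = v - (f v * (f (a j))⁻¹) • a j := by
          intro v; simp [π, smul_smul]
        rcases ih (fun i => π (a i)) (π b) with ⟨c, hc, hbe⟩ | ⟨g, hg, hgb⟩
        · left
          set t : ℝ := f b * (f (a j))⁻¹ - ∑ i ∈ s, c i * (f (a i) * (f (a j))⁻¹) with ht
          have hinv : (f (a j))⁻¹ < 0 := inv_lt_zero.2 h
          refine ⟨fun i => if i = j then t else c i, ?_, ?_⟩
          · intro i hi
            dsimp only
            split_ifs with h'
            · have h1 : 0 ≤ f b * (f (a j))⁻¹ := (mul_pos_of_neg_of_neg hfb hinv).le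
              have h2 : ∑ i ∈ s, c i * (f (a i) * (f (a j))⁻¹) ≤ 0 :=
                Finset.sum_nonpos fun i hi =>
                  mul_nonpos_of_nonneg_of_nonpos (hc i hi)
                    (mul_nonpos_of_nonneg_of_nonpos (hf i hi) hinv.le)
              linarith
            · exact hc i ((Finset.mem_insert.1 hi).resolve_left h')
          · rw [Finset.sum_insert hj]
            simp only [if_true]
            have e1 : ∑ i ∈ s, (if i = j then t else c i) • a i = ∑ i ∈ s, c i • a i :=
              Finset.sum_congr rfl fun i hi => by rw [if_neg (fun (h' : i = j) => hj (h' ▸ hi))]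
            rw [e1]
            simp only [hπ, smul_sub, Finset.sum_sub_distrib, smul_smul] at hbe
            rw [← Finset.sum_smul] at hbe
            rw [ht, sub_smul]
            rw [sub_eq_iff_eq_add] at hbe
            refine hbe.trans ?_
            module
        · right
          refine ⟨g ∘ₗ π, fun i hi => ?_, hgb⟩
          rcases Finset.mem_insert.1 hi with rfl | h'
          · rw [LinearMap.comp_apply, hπ, mul_inv_cancel₀ h.ne, one_smul, sub_self, map_zero]
          · exact hg i h'

lemma exists_separating {X : Set V} (hX : X.Finite) {b : V} (hb : b ∉ cone X) :
    ∃ f : V →ₗ[ℝ] ℝ, (∀ x ∈ X, 0 ≤ f x) ∧ f b < 0 := by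
  rcases farkas hX.toFinset (fun x => x) b with ⟨c, hc, h⟩ | ⟨f, hf, h⟩
  · exfalso
    apply hb
    rw [h]
    exact cone_sum _ _ _ hc (fun i hi => hX.mem_toFinset.1 hi)
  · exact ⟨f, fun x hx => hf x (hX.mem_toFinset.2 hx), h⟩

section
variable {B : LinearMap.BilinForm ℝ V} {Δ : Set V} (hb : IsBasedRootSystem B Δ)
  (hfin : (rootSystem B Δ).Finite)

include hb in
lemma exists_coord (α : V) :
    ∃ f : V →ₗ[ℝ] ℝ, (∀ γ ∈ Δ, γ ≠ α → f γ = 0) ∧ (α ∈ Δ → f α = 1) := by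
  classical
  obtain ⟨f, hf⟩ := exists_functional hb (fun γ => if γ = α then 1 else 0)
  exact ⟨f, fun γ hγ h => by rw [hf γ hγ, if_neg h], fun h => by rw [hf α h, if_pos rfl]⟩

/-- Coordinate functional of a simple root. -/
noncomputable def coord (α : V) : V →ₗ[ℝ] ℝ := Classical.choose (exists_coord hb α)

lemma coord_ne {α γ : V} (hγ : γ ∈ Δ) (h : γ ≠ α) : coord hb α γ = 0 :=
  (Classical.choose_spec (exists_coord hb α)).1 γ hγ h

lemma coord_self {α : V} (hα : α ∈ Δ) : coord hb α α = 1 :=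
  (Classical.choose_spec (exists_coord hb α)).2 hα

lemma expand {v : V} (hv : v ∈ Submodule.span ℝ Δ) :
    v = ∑ α ∈ hb.finite.toFinset, coord hb α v • α := by
  induction hv using Submodule.span_induction with
  | mem x hx =>
    rw [Finset.sum_eq_single x]
    · rw [coord_self hb hx, one_smul]
    · intro γ hγ hne
      rw [coord_ne hb hx hne.symm, zero_smul]
    · intro h
      exact absurd (hb.finite.mem_toFinset.2 hx) h
  | zero => simp
  | add x y _ _ hx hy =>
    simp only [map_add, add_smul, Finset.sum_add_distrib]
    rw [← hx, ← hy]
  | smul c x _ hx =>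
    simp only [map_smul, smul_eq_mul, mul_smul]
    rw [← Finset.smul_sum, ← hx]

lemma apply_expand {v : V} (hv : v ∈ Submodule.span ℝ Δ) (f : V →ₗ[ℝ] ℝ) :
    f v = ∑ α ∈ hb.finite.toFinset, coord hb α v * f α := by
  conv_lhs => rw [expand hb hv]
  simp

lemma mem_cone_of_coord {v : V} (hv : v ∈ Submodule.span ℝ Δ)
    (h : ∀ α ∈ Δ, 0 ≤ coord hb α v) : v ∈ cone Δ := by
  rw [expand hb hv]
  exact cone_sum _ _ _ (fun i hi => h i (hb.finite.mem_toFinset.1 hi))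
    (fun i hi => hb.finite.mem_toFinset.1 hi)

lemma coord_nonneg {v : V} (hv : v ∈ cone Δ) (α : V) (hα : α ∈ Δ) : 0 ≤ coord hb α v := by
  refine cone_nonneg (fun x hx => ?_) hv
  by_cases h : x = α
  · rw [h, coord_self hb hα]; norm_num
  · rw [coord_ne hb hx h]

include hb in
/-- A root does not vanish on the open chamber. -/
lemma root_ne_of_pos (hfin : (rootSystem B Δ).Finite) {β : V} (hβ : β ∈ rootSystem B Δ)
    {f : V →ₗ[ℝ] ℝ} (hf : ∀ α ∈ Δ, 0 < f α) : f β ≠ 0 := by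
  intro h0
  obtain ⟨s, hs, hsv⟩ := exists_refl hb hβ
  have hββ := root_norm hb hβ
  obtain ⟨ε, hε, hεΔ⟩ : ∃ ε : ℝ, 0 < ε ∧ ∀ α ∈ Δ, ε * |B α β| ≤ f α := by
    rcases Δ.eq_empty_or_nonempty with h | hne
    · exact ⟨1, one_pos, by simp [h]⟩
    obtain ⟨a, ha, hmin⟩ := Set.exists_min_image Δ (fun α => f α / (|B α β| + 1)) hb.finite hne
    refine ⟨f a / (|B a β| + 1), div_pos (hf a ha) (by positivity), fun α hα => ?_⟩
    have h1 := hmin α hα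
    have h2 : 0 ≤ |B α β| := abs_nonneg _
    calc f a / (|B a β| + 1) * |B α β| ≤ f α / (|B α β| + 1) * |B α β| :=
          mul_le_mul_of_nonneg_right h1 h2
      _ = f α * (|B α β| / (|B α β| + 1)) := by ring
      _ ≤ f α * 1 := by
          apply mul_le_mul_of_nonneg_left _ (hf α hα).le
          rw [div_le_one (by positivity)]; linarith
      _ = f α := mul_one _
  have d1 : Dom Δ (f + ε • B.flip β) := by
    intro α hα
    have := hεΔ α hα
    have h3 : -|B α β| ≤ B α β := neg_abs_le _
    simp only [LinearMap.add_apply, LinearMap.smul_apply, LinearMap.BilinForm.flip_apply,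
      smul_eq_mul]
    nlinarith
  have e : act (f + ε • B.flip β) s = f - ε • B.flip β := by
    ext v
    simp only [act_apply, LinearMap.add_apply, LinearMap.sub_apply, LinearMap.smul_apply,
      LinearMap.BilinForm.flip_apply, smul_eq_mul, hsv, map_sub, map_smul, h0, hββ]
    ring
  have d2 : Dom Δ (act (f + ε • B.flip β) s) := by
    rw [e]
    intro α hα
    have := hεΔ α hα
    have h3 : B α β ≤ |B α β| := le_abs_self _
    simp only [LinearMap.sub_apply, LinearMap.smul_apply, LinearMap.BilinForm.flip_apply,
      smul_eq_mul]
    nlinarith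
  have := dom_unique hb hfin hs d1 d2
  rw [e] at this
  have h4 := LinearMap.congr_fun this β
  simp only [LinearMap.add_apply, LinearMap.sub_apply, LinearMap.smul_apply,
    LinearMap.BilinForm.flip_apply, smul_eq_mul, hββ, h0] at h4
  linarith

include hb hfin in
lemma pos_or_neg {β : V} (hβ : β ∈ rootSystem B Δ) :
    β ∈ positiveRoots B Δ ∨ -β ∈ positiveRoots B Δ := by
  have hsp := root_span hβ
  by_contra hcon
  push Not at hcon
  obtain ⟨h1, h2⟩ := hcon
  have n1 : ∃ ε ∈ Δ, coord hb ε β < 0 := by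
    by_contra h
    push Not at h
    exact h1 ⟨hβ, mem_cone_of_coord hb hsp h⟩
  have n2 : ∃ δ ∈ Δ, 0 < coord hb δ β := by
    by_contra h
    push Not at h
    refine h2 ⟨root_neg hb hβ, mem_cone_of_coord hb (neg_mem hsp) fun α hα => ?_⟩
    rw [map_neg]
    linarith [h α hα]
  obtain ⟨ε, hε, hεn⟩ := n1
  obtain ⟨δ, hδ, hδp⟩ := n2
  obtain ⟨f0, hf0⟩ := exists_functional hb (fun _ => 1)
  have cn : ∀ γ ∈ Δ, ∀ α ∈ Δ, 0 ≤ coord hb γ α := by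
    intro γ hγ α hα
    by_cases h : α = γ
    · rw [h, coord_self hb hγ]; norm_num
    · rw [coord_ne hb hα h]
  rcases le_total (f0 β) 0 with h | h
  · refine root_ne_of_pos hb hfin hβ (f := f0 + (-f0 β / coord hb δ β) • coord hb δ) ?_ ?_
    · intro α hα
      have : 0 ≤ (-f0 β / coord hb δ β) * coord hb δ α :=
        mul_nonneg (div_nonneg (by linarith) hδp.le) (cn δ hδ α hα)
      simp only [LinearMap.add_apply, LinearMap.smul_apply, smul_eq_mul, hf0 α hα]
      linarith
    · simp only [LinearMap.add_apply, LinearMap.smul_apply, smul_eq_mul]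
      field_simp
      ring
  · refine root_ne_of_pos hb hfin hβ (f := f0 + (-f0 β / coord hb ε β) • coord hb ε) ?_ ?_
    · intro α hα
      have : 0 ≤ (-f0 β / coord hb ε β) * coord hb ε α :=
        mul_nonneg (div_nonneg_of_nonpos (by linarith) hεn.le) (cn ε hε α hα)
      simp only [LinearMap.add_apply, LinearMap.smul_apply, smul_eq_mul, hf0 α hα]
      linarith
    · have := hεn.ne
      simp only [LinearMap.add_apply, LinearMap.smul_apply, smul_eq_mul]
      field_simp
      ring

include hb in
lemma pos_not_neg {β : V} (hβ : β ∈ positiveRoots B Δ) : -β ∉ positiveRoots B Δ := by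
  intro h
  apply root_ne_zero hb hβ.1
  rw [expand hb (root_span hβ.1)]
  refine Finset.sum_eq_zero fun α hα => ?_
  have hα := hb.finite.mem_toFinset.1 hα
  have h1 := coord_nonneg hb hβ.2 α hα
  have h2 := coord_nonneg hb h.2 α hα
  rw [map_neg] at h2
  rw [le_antisymm (by linarith) h1, zero_smul]

include hb hfin in
/-- A simple reflection permutes the other positive roots. -/
lemma s_pos {α β : V} (hα : α ∈ Δ) (hβ : β ∈ positiveRoots B Δ) (hne : β ≠ α) :
    sref B α β ∈ positiveRoots B Δ := by
  have hr : sref B α β ∈ rootSystem B Δ := root_w (s_mem hb hα) hβ.1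
  rcases pos_or_neg hb hfin hr with h | h
  · exact h
  exfalso
  have hz : ∀ γ ∈ Δ, γ ≠ α → coord hb γ β = 0 := by
    intro γ hγ hγα
    have h1 := coord_nonneg hb hβ.2 γ hγ
    have h2 := coord_nonneg hb h.2 γ hγ
    rw [s_apply hb hα, map_neg, map_sub, map_smul, coord_ne hb hα hγα.symm, smul_zero] at h2
    linarith
  have hmul : β = coord hb α β • α := by
    conv_lhs => rw [expand hb (root_span hβ.1)]
    refine Finset.sum_eq_single α ?_ ?_
    · intro γ hγ hγα
      rw [hz γ (hb.finite.mem_toFinset.1 hγ) hγα, zero_smul]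
    · intro h; exact absurd (hb.finite.mem_toFinset.2 hα) h
  have hn := root_norm hb hβ.1
  set c := coord hb α β with hc
  have hc0 : 0 ≤ c := coord_nonneg hb hβ.2 α hα
  rw [hmul] at hn
  simp only [map_smul, LinearMap.smul_apply, smul_eq_mul, hb.diag_one α hα] at hn
  have : c = 1 := by nlinarith
  rw [this, one_smul] at hmul
  exact hne hmul

include hb hfin in
/-- Every functional is nonnegative on some translate of the positive roots. -/
lemma exists_dom (f : V →ₗ[ℝ] ℝ) :
    ∃ w ∈ weylGroup B Δ, ∀ β ∈ positiveRoots B Δ, 0 ≤ f (w β) := by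
  obtain ⟨w, hw, -, hd⟩ := exists_dom_reach hb hfin f
  exact ⟨w, hw, fun β hβ => cone_nonneg (f := act f w) hd hβ.2⟩

end

/-! ### The oriented matroid argument -/

section
variable {B : LinearMap.BilinForm ℝ V} {Δ : Set V} (hb : IsBasedRootSystem B Δ)
  (hfin : (rootSystem B Δ).Finite) {d : Set V → Set V} (hd : IsOMRS B Δ d)

lemma image_pos_sub {w : V ≃ₗ[ℝ] V} (hw : w ∈ weylGroup B Δ) :
    (⇑w '' positiveRoots B Δ) ⊆ rootSystem B Δ := by
  rintro _ ⟨β, hβ, rfl⟩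
  exact root_w hw hβ.1

include hd in
lemma d_image_pos {w : V ≃ₗ[ℝ] V} (hw : w ∈ weylGroup B Δ) :
    d (⇑w '' positiveRoots B Δ) = ⇑w '' positiveRoots B Δ := by
  rw [hd.equivariant w hw _ (fun _ h => h.1), hd.positive_closed]

include hb hfin in
lemma image_or_neg {w : V ≃ₗ[ℝ] V} (hw : w ∈ weylGroup B Δ) {x : V} (hx : x ∈ rootSystem B Δ) :
    x ∈ ⇑w '' positiveRoots B Δ ∨ -x ∈ ⇑w '' positiveRoots B Δ := by
  have e : w (w⁻¹ x) = x := by rw [← LinearEquiv.mul_apply, mul_inv_cancel]; rfl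
  rcases pos_or_neg hb hfin (root_w (inv_mem hw) hx) with h | h
  · exact Or.inl ⟨_, h, e⟩
  · exact Or.inr ⟨_, h, by rw [map_neg, e]⟩

include hb in
lemma image_asym {w : V ≃ₗ[ℝ] V} {x : V} (hx : x ∈ ⇑w '' positiveRoots B Δ) :
    -x ∉ ⇑w '' positiveRoots B Δ := by
  obtain ⟨β, hβ, rfl⟩ := hx
  rintro ⟨γ, hγ, h⟩
  rw [← map_neg] at h
  have := w.injective h
  rw [this] at hγ
  exact pos_not_neg hb hβ hγ

include hd in
lemma asym_extend {R : Set V} (hR : R ⊆ rootSystem B Δ) (has : ∀ x ∈ d R, -x ∉ d R) {y : V}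
    (hy : y ∈ rootSystem B Δ) (hny : -y ∉ d R) :
    ∀ z ∈ d (R ∪ {y}), -z ∉ d (R ∪ {y}) := by
  have om := hd.om
  have hRy : R ∪ {y} ⊆ rootSystem B Δ :=
    Set.union_subset hR (Set.singleton_subset_iff.2 hy)
  have hny' := om.neg_mem y hy
  -- one-sided version
  have key : ∀ z ∈ d (R ∪ {y}), -z ∈ d (R ∪ {y}) → z ∈ d R := by
    intro z hz hnz
    by_contra hzR
    have hzΦ := om.cx_le_ground _ hRy hz
    have h1 : -y ∈ d ((R \ {-y}) ∪ {-z}) :=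
      om.exchange3 R hR z hzΦ (-y) hny' (by rwa [neg_neg]) hzR
    have hsub : (R \ {-y}) ∪ {-z} ⊆ d (R ∪ {y}) := by
      refine Set.union_subset ?_ (Set.singleton_subset_iff.2 hnz)
      exact fun a ha => om.le_cx _ hRy (Or.inl ha.1)
    have h2 : -y ∈ d (R ∪ {y}) := by
      have := om.cx_mono _ _ hsub (om.cx_le_ground _ hRy) h1
      rwa [om.cx_idem _ hRy] at this
    exact hny (om.exchange2 R hR (-y) hny' (by rwa [neg_neg]))
  intro z hz hnz
  exact has z (key z hz hnz) (key (-z) hnz (by rwa [neg_neg]))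

include hfin hd in
lemma exists_tope {Z : Set V} (hZ : Z ⊆ rootSystem B Δ) (has : ∀ x ∈ d Z, -x ∉ d Z) :
    ∃ R, Z ⊆ R ∧ R ⊆ rootSystem B Δ ∧ d R = R ∧ (∀ x ∈ R, -x ∉ R) ∧
      ∀ x ∈ rootSystem B Δ, x ∈ R ∨ -x ∈ R := by
  have om := hd.om
  let S : Set (Set V) := {R | R ⊆ rootSystem B Δ ∧ d R = R ∧ ∀ x ∈ R, -x ∉ R}
  have hS : S.Finite := hfin.finite_subsets.subset fun R hR => hR.1
  obtain ⟨R, hle, hmax⟩ := hS.exists_le_maximal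
    (show d Z ∈ S from ⟨om.cx_le_ground _ hZ, om.cx_idem _ hZ, has⟩)
  obtain ⟨⟨hR, hRd, hRa⟩, hmax⟩ := hmax
  refine ⟨R, (om.le_cx _ hZ).trans hle, hR, hRd, hRa, fun x hx => ?_⟩
  by_contra hcon
  push Not at hcon
  have hsub : R ∪ {x} ⊆ rootSystem B Δ := Set.union_subset hR (Set.singleton_subset_iff.2 hx)
  have hA := asym_extend hd hR (by rwa [hRd]) hx (by rw [hRd]; exact hcon.2)
  have := hmax (y := d (R ∪ {x})) ⟨om.cx_le_ground _ hsub, om.cx_idem _ hsub, hA⟩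
    (fun a ha => om.le_cx _ hsub (Or.inl ha))
  exact hcon.1 (this (om.le_cx _ hsub (Or.inr rfl)))

include hb hfin hd in
lemma generate {R : Set V} (hR : R ⊆ rootSystem B Δ) (hRd : d R = R) {w : V ≃ₗ[ℝ] V}
    (hw : w ∈ weylGroup B Δ) (hΔ : ∀ α ∈ Δ, w α ∈ R) : ∀ β ∈ positiveRoots B Δ, w β ∈ R := by
  by_contra hcon
  push Not at hcon
  obtain ⟨f0, hf0⟩ := exists_functional hb (fun _ => 1)
  obtain ⟨β, ⟨hβ, hβR⟩, hmin⟩ := Set.exists_min_image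
    {β | β ∈ positiveRoots B Δ ∧ w β ∉ R} f0 (hfin.subset fun β h => h.1.1) hcon
  obtain ⟨α, hα, hpos⟩ : ∃ α ∈ Δ, 0 < B β α := by
    by_contra h
    push Not at h
    have h1 := apply_expand hb (root_span hβ.1) (B β)
    rw [root_norm hb hβ.1] at h1
    have h2 : ∑ α ∈ hb.finite.toFinset, coord hb α β * B β α ≤ 0 :=
      Finset.sum_nonpos fun α hα => mul_nonpos_of_nonneg_of_nonpos
        (coord_nonneg hb hβ.2 α (hb.finite.mem_toFinset.1 hα))
        (h α (hb.finite.mem_toFinset.1 hα))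
    linarith
  have hne : β ≠ α := fun h => hβR (h ▸ hΔ α hα)
  have hs := s_pos hb hfin hα hβ hne
  have hsR : w (sref B α β) ∈ R := by
    by_contra h
    have := hmin _ ⟨hs, h⟩
    rw [s_apply hb hα, map_sub, map_smul, hf0 α hα, smul_eq_mul] at this
    linarith
  have hsub : ({w (sref B α β), w α} : Set V) ⊆ R := by
    intro x hx
    rcases hx with rfl | rfl
    · exact hsR
    · exact hΔ α hα
  have hrk : Module.rank ℝ (Submodule.span ℝ ({w (sref B α β), w α} : Set V)) ≤ 2 := by
    refine (rank_span_le _).trans ?_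
    refine (Cardinal.mk_insert_le).trans ?_
    rw [Cardinal.mk_singleton, one_add_one_eq_two]
  have hd2 := hd.rank_two _ (hsub.trans hR) hrk
  apply hβR
  rw [← hRd]
  apply hd.om.cx_mono _ _ hsub hR
  rw [hd2]
  refine ⟨⟨2, ![1, 2 * B β α], ![w (sref B α β), w α], ?_, ?_, ?_⟩, root_w hw hβ.1⟩
  · intro i
    fin_cases i
    · simp
    · simp [hpos.le]
  · intro i
    fin_cases i <;> simp
  · rw [Fin.sum_univ_two]
    simp only [Matrix.cons_val_zero, Matrix.cons_val_one, one_smul]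
    rw [← map_smul, ← map_add, s_apply hb hα]
    simp

include hb hfin hd in
lemma tope_eq {R : Set V} (hR : R ⊆ rootSystem B Δ) (hRd : d R = R) (hRa : ∀ x ∈ R, -x ∉ R)
    (hRt : ∀ x ∈ rootSystem B Δ, x ∈ R ∨ -x ∈ R) :
    ∃ w ∈ weylGroup B Δ, R = ⇑w '' positiveRoots B Δ := by
  let cnt : (V ≃ₗ[ℝ] V) → ℕ := fun w => (R ∩ ⇑w '' positiveRoots B Δ).ncard
  have hRfin : R.Finite := hfin.subset hR
  have hbdd : ∀ w, cnt w ≤ R.ncard := fun w => Set.ncard_le_ncard Set.inter_subset_left hRfin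
  have hTfin : (cnt '' {w | w ∈ weylGroup B Δ}).Finite :=
    (Set.finite_Iic R.ncard).subset (by rintro _ ⟨w, _, rfl⟩; exact hbdd w)
  obtain ⟨_, ⟨w, hw, rfl⟩, hmax⟩ := Set.exists_max_image _ id hTfin ⟨_, 1, (weylGroup B Δ).one_mem, rfl⟩
  have hw : w ∈ weylGroup B Δ := hw
  have hΔ : ∀ α ∈ Δ, w α ∈ R := by
    intro α hα
    by_contra hcon
    have hneg : -(w α) ∈ R := (hRt _ (root_w hw (simple_root hα))).resolve_left hcon
    have hwα : w α ∈ ⇑w '' positiveRoots B Δ := by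
      refine ⟨α, ⟨simple_root hα, mem_cone_of_coord hb (Submodule.subset_span hα) ?_⟩, rfl⟩
      intro γ hγ
      by_cases h : α = γ
      · rw [h, coord_self hb hγ]; norm_num
      · rw [coord_ne hb hα h]
    have hαp : α ∈ positiveRoots B Δ := by
      obtain ⟨γ, hγ, h⟩ := hwα
      exact w.injective h ▸ hγ
    have hlt : cnt w < cnt (w * sref B α) := by
      refine Set.ncard_lt_ncard ⟨?_, ?_⟩ (hRfin.subset Set.inter_subset_left)
      · rintro _ ⟨hxR, β, hβ, rfl⟩
        refine ⟨hxR, sref B α β, s_pos hb hfin hα hβ ?_, ?_⟩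
        · rintro rfl; exact hcon hxR
        · rw [LinearEquiv.mul_apply, s_s hb hα]
      · intro hsub
        have : -(w α) ∈ R ∩ ⇑(w * sref B α) '' positiveRoots B Δ :=
          ⟨hneg, α, hαp, by rw [LinearEquiv.mul_apply, s_self hb hα, map_neg]⟩
        exact image_asym hb hwα (hsub this).2
    have := hmax _ ⟨w * sref B α, mul_mem hw (s_mem hb hα), rfl⟩
    simp only [id] at this
    omega
  have hsub := generate hb hfin hd hR hRd hw hΔ
  refine ⟨w, hw, Set.Subset.antisymm (fun x hx => ?_) ?_⟩
  · rcases image_or_neg hb hfin hw (hR hx) with h | h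
    · exact h
    · obtain ⟨β, hβ, h⟩ := h
      exact absurd (h ▸ hsub β hβ) (hRa x hx)
  · rintro _ ⟨β, hβ, rfl⟩
    exact hsub β hβ

include hb hfin hd in
/-- Independent case of `cone ⊆ d`. -/
lemma cone_sub_indep {s : Finset V} (hs : ↑s ⊆ rootSystem B Δ)
    (hli : LinearIndepOn ℝ id (s : Set V)) {x : V} (hx : x ∈ rootSystem B Δ)
    (hxc : x ∈ cone (s : Set V)) : x ∈ d s := by
  by_contra hcon
  have om := hd.om
  -- a functional equal to one on `s`
  obtain ⟨f, hf⟩ : ∃ f : V →ₗ[ℝ] ℝ, ∀ y ∈ s, f y = 1 := by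
    let b := Module.Basis.extend hli
    refine ⟨b.constr ℝ (fun _ => 1), fun α hα => ?_⟩
    have h : b ⟨α, hli.subset_extend (Set.subset_univ _) hα⟩ = α := by
      simp [b, Module.Basis.extend_apply_self]
    conv_lhs => rw [← h]
    rw [Module.Basis.constr_basis]
  obtain ⟨w, hw, hdom⟩ := exists_dom hb hfin f
  have hsw : ↑s ⊆ ⇑w '' positiveRoots B Δ := by
    intro y hy
    rcases image_or_neg hb hfin hw (hs hy) with h | ⟨β, hβ, h⟩
    · exact h
    · have h1 := hdom β hβ
      rw [h, map_neg, hf y hy] at h1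
      linarith
  have hds : d s ⊆ ⇑w '' positiveRoots B Δ := by
    have := om.cx_mono _ _ hsw (image_pos_sub hw)
    rwa [d_image_pos hd hw] at this
  have has : ∀ y ∈ d s, -y ∉ d s := fun y hy hny => image_asym hb (hds hy) (hds hny)
  have hnx := root_neg hb hx
  have hA := asym_extend hd hs has hnx (by rwa [neg_neg])
  obtain ⟨R, hZR, hR, hRd, hRa, hRt⟩ := exists_tope hfin hd
    (Set.union_subset hs (Set.singleton_subset_iff.2 hnx)) hA
  obtain ⟨u, hu, rfl⟩ := tope_eq hb hfin hd hR hRd hRa hRt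
  have hcone : ∀ v ∈ cone (s : Set V), u⁻¹ v ∈ cone Δ := by
    intro v hv
    have hsp : ∀ y ∈ s, u⁻¹ y ∈ positiveRoots B Δ := by
      intro y hy
      obtain ⟨β, hβ, h⟩ := hZR (Or.inl hy)
      rw [← h, ← LinearEquiv.mul_apply, inv_mul_cancel]
      exact hβ
    have hvs : u⁻¹ v ∈ Submodule.span ℝ Δ := by
      obtain ⟨n, c, y, hc, hy, rfl⟩ := hv
      rw [map_sum]
      refine sum_mem fun i _ => ?_
      rw [map_smul]
      exact Submodule.smul_mem _ _ (root_span (hsp _ (hy i)).1)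
    refine mem_cone_of_coord hb hvs fun α hα => ?_
    exact cone_nonneg (f := act (coord hb α) u⁻¹)
      (fun y hy => coord_nonneg hb (hsp y hy).2 α hα) hv
  have h1 : u⁻¹ x ∈ positiveRoots B Δ := ⟨root_w (inv_mem hu) hx, hcone x hxc⟩
  obtain ⟨β, hβ, h⟩ := hZR (Or.inr rfl)
  have h2 : -(u⁻¹ x) ∈ positiveRoots B Δ := by
    rw [← map_neg, ← h, ← LinearEquiv.mul_apply, inv_mul_cancel]
    exact hβ
  exact pos_not_neg hb h1 h2

/-- Carathéodory reduction step. -/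
lemma cara_step {s : Finset V} (hli : ¬ LinearIndepOn ℝ id (s : Set V)) {c : V → ℝ}
    (hc : ∀ y ∈ s, 0 ≤ c y) :
    ∃ y0 ∈ s, ∃ c' : V → ℝ, (∀ y ∈ s, 0 ≤ c' y) ∧ c' y0 = 0 ∧
      ∑ y ∈ s, c' y • y = ∑ y ∈ s, c y • y := by
  have hex : ∃ a : V → ℝ, ∑ y ∈ s, a y • y = 0 ∧ ∃ y ∈ s, 0 < a y := by
    have hli' : ¬ LinearIndepOn ℝ id (s : Set V) := hli
    rw [linearIndepOn_finset_iff] at hli'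
    push Not at hli'
    obtain ⟨a, ha, y, hy, hne⟩ := hli'
    rcases lt_or_gt_of_ne hne with h | h
    · refine ⟨fun y => -a y, ?_, y, hy, by simpa using h⟩
      simp only [neg_smul, Finset.sum_neg_distrib]
      simpa using ha
    · exact ⟨a, ha, y, hy, h⟩
  obtain ⟨a, ha, y1, hy1, hpos⟩ := hex
  obtain ⟨y0, hy0, hmin⟩ := Finset.exists_min_image (s.filter fun y => 0 < a y)
    (fun y => c y / a y) ⟨y1, Finset.mem_filter.2 ⟨hy1, hpos⟩⟩
  obtain ⟨hy0s, hy0p⟩ := Finset.mem_filter.1 hy0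
  refine ⟨y0, hy0s, fun y => c y - c y0 / a y0 * a y, fun y hy => ?_, ?_, ?_⟩
  · have ht : 0 ≤ c y0 / a y0 := div_nonneg (hc _ hy0s) hy0p.le
    rcases le_or_gt (a y) 0 with h | h
    · have := hc y hy
      nlinarith [mul_nonneg ht (neg_nonneg.2 h)]
    · have h1 := hmin y (Finset.mem_filter.2 ⟨hy, h⟩)
      rw [le_div_iff₀ h] at h1
      linarith
  · field_simp
    ring
  · simp only [sub_smul, Finset.sum_sub_distrib, mul_smul]
    rw [← Finset.smul_sum, ha, smul_zero, sub_zero]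

include hb hfin hd in
lemma cone_sub_finset : ∀ (n : ℕ) (s : Finset V), s.card = n → ↑s ⊆ rootSystem B Δ →
    ∀ (c : V → ℝ), (∀ y ∈ s, 0 ≤ c y) → ∑ y ∈ s, c y • y ∈ rootSystem B Δ →
    ∑ y ∈ s, c y • y ∈ d s := by
  classical
  intro n
  induction n with
  | zero =>
    intro s hs _ c _ hx
    rw [Finset.card_eq_zero] at hs
    subst hs
    simp only [Finset.sum_empty] at hx
    exact absurd rfl (root_ne_zero hb hx)
  | succ n ih =>
    intro s hs hsΦ c hc hx
    by_cases hli : LinearIndepOn ℝ id (s : Set V)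
    · exact cone_sub_indep hb hfin hd hsΦ hli hx (cone_sum s c _ hc (fun i hi => hi))
    · obtain ⟨y0, hy0, c', hc', h0, he⟩ := cara_step hli hc
      have he' : ∑ y ∈ s.erase y0, c' y • y = ∑ y ∈ s, c y • y := by
        rw [← he, ← Finset.add_sum_erase s _ hy0, h0, zero_smul, zero_add]
      have hsub : ((s.erase y0 : Finset V) : Set V) ⊆ s := by
        intro y hy; exact Finset.mem_of_mem_erase hy
      have := ih (s.erase y0) (by rw [Finset.card_erase_of_mem hy0, hs]; rfl) (hsub.trans hsΦ) c'
        (fun y hy => hc' y (hsub hy)) (by rwa [he'])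
      rw [he'] at this
      exact hd.om.cx_mono _ _ hsub hsΦ this

include hb hfin hd in
lemma cone_sub {X : Set V} (hX : X ⊆ rootSystem B Δ) : cone X ∩ rootSystem B Δ ⊆ d X := by
  rintro x ⟨hx, hxΦ⟩
  obtain ⟨s, c, hs, hc, rfl⟩ := cone_mem_iff hx
  exact hd.om.cx_mono _ _ hs hX
    (cone_sub_finset hb hfin hd _ s rfl (hs.trans hX) c hc hxΦ)

/-- Closed half spaces of roots. -/
def Hs (B : LinearMap.BilinForm ℝ V) (Δ : Set V) (f : V →ₗ[ℝ] ℝ) : Set V :=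
  {β | β ∈ rootSystem B Δ ∧ 0 ≤ f β}

/-- Span of the roots in the kernel. -/
def Ks (B : LinearMap.BilinForm ℝ V) (Δ : Set V) (f : V →ₗ[ℝ] ℝ) : Submodule ℝ V :=
  Submodule.span ℝ {β | β ∈ rootSystem B Δ ∧ f β = 0}

lemma Hs_act {w : V ≃ₗ[ℝ] V} (hw : w ∈ weylGroup B Δ) (f : V →ₗ[ℝ] ℝ) :
    Hs B Δ f = ⇑w '' Hs B Δ (act f w) := by
  ext x
  constructor
  · rintro ⟨hx, hf⟩
    have e : w (w⁻¹ x) = x := by rw [← LinearEquiv.mul_apply, mul_inv_cancel]; rfl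
    exact ⟨w⁻¹ x, ⟨root_w (inv_mem hw) hx, by rwa [act_apply, e]⟩, e⟩
  · rintro ⟨y, ⟨hy, hf⟩, rfl⟩
    exact ⟨root_w hw hy, hf⟩

lemma Ks_act {w : V ≃ₗ[ℝ] V} (hw : w ∈ weylGroup B Δ) (f : V →ₗ[ℝ] ℝ) :
    Module.finrank ℝ (Ks B Δ (act f w)) = Module.finrank ℝ (Ks B Δ f) := by
  have : Ks B Δ f = (Ks B Δ (act f w)).map (w : V →ₗ[ℝ] V) := by
    unfold Ks
    rw [Submodule.map_span]
    congr 1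
    ext x
    constructor
    · rintro ⟨hx, hf⟩
      have e : w (w⁻¹ x) = x := by rw [← LinearEquiv.mul_apply, mul_inv_cancel]; rfl
      exact ⟨w⁻¹ x, ⟨root_w (inv_mem hw) hx, by rwa [act_apply, e]⟩, e⟩
    · rintro ⟨y, ⟨hy, hf⟩, rfl⟩
      exact ⟨root_w hw hy, hf⟩
  rw [this]
  exact (LinearEquiv.finrank_map_eq w _).symm

include hb hfin hd in
lemma half_closed [FiniteDimensional ℝ V] : ∀ (n : ℕ) (f : V →ₗ[ℝ] ℝ),
    Module.finrank ℝ (Ks B Δ f) = n → d (Hs B Δ f) ⊆ Hs B Δ f := by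
  have om := hd.om
  have hHs : ∀ f, Hs B Δ f ⊆ rootSystem B Δ := fun f x hx => hx.1
  intro n
  induction n using Nat.strong_induction_on with
  | _ n ih =>
  -- reduction to dominant functionals
  suffices hmain : ∀ f : V →ₗ[ℝ] ℝ, Dom Δ f → Module.finrank ℝ (Ks B Δ f) = n →
      d (Hs B Δ f) ⊆ Hs B Δ f by
    intro f hf
    obtain ⟨w, hw, -, hdom⟩ := exists_dom_reach hb hfin f
    rw [Hs_act hw f, hd.equivariant w hw _ (hHs _)]
    exact Set.image_mono (hmain _ hdom (by rw [Ks_act hw, hf]))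
  intro f hdom hf
  by_cases hJ : ∃ α ∈ Δ, f α = 0
  swap
  · -- no simple root in the kernel: this is the set of positive roots
    push Not at hJ
    have hpos : ∀ α ∈ Δ, 0 < f α := fun α hα => lt_of_le_of_ne (hdom α hα) (hJ α hα).symm
    have he : Hs B Δ f = positiveRoots B Δ := by
      ext x
      constructor
      · rintro ⟨hx, hfx⟩
        rcases pos_or_neg hb hfin hx with h | h
        · exact h
        · have h1 := cone_nonneg hdom h.2
          rw [map_neg] at h1
          exact absurd (le_antisymm (by linarith) hfx) (root_ne_of_pos hb hfin hx hpos)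
      · intro hx
        exact ⟨hx.1, cone_nonneg hdom hx.2⟩
    rw [he, hd.positive_closed]
  obtain ⟨α, hα, hfα⟩ := hJ
  have hαΦ : α ∈ rootSystem B Δ := simple_root hα
  set a := coord hb α with ha
  have haα : a α = 1 := coord_self hb hα
  -- choose a large multiple of `f`
  obtain ⟨N, hN0, hN⟩ : ∃ N : ℝ, 0 < N ∧ ∀ β ∈ rootSystem B Δ, f β ≠ 0 → |a β| < N * |f β| := by
    obtain ⟨β0, hβ0, hmax⟩ := Set.exists_max_image (rootSystem B Δ)
      (fun β => |a β| / |f β|) hfin ⟨α, hαΦ⟩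
    refine ⟨|a β0| / |f β0| + 1, by positivity, fun β hβ hne => ?_⟩
    have h1 := hmax β hβ
    have h2 : 0 < |f β| := abs_pos.2 hne
    rw [← div_lt_iff₀ h2]
    linarith
  set f' := N • f + a with hf'
  set g := N • f - a with hg
  have f'_apply : ∀ v, f' v = N * f v + a v := fun v => by simp [hf']
  have g_apply : ∀ v, g v = N * f v - a v := fun v => by simp [hg]
  have hpos : ∀ β ∈ rootSystem B Δ, 0 < f β → 0 < f' β ∧ 0 < g β := by
    intro β hβ h
    have h1 := hN β hβ h.ne'
    rw [abs_of_pos h] at h1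
    rw [f'_apply, g_apply]
    constructor <;> linarith [neg_abs_le (a β), le_abs_self (a β)]
  have hneg : ∀ β ∈ rootSystem B Δ, f β < 0 → f' β < 0 ∧ g β < 0 := by
    intro β hβ h
    have := hpos (-β) (root_neg hb hβ) (by rw [map_neg]; linarith)
    simp only [map_neg] at this
    constructor <;> linarith [this.1, this.2]
  have hker : ∀ β ∈ rootSystem B Δ, (f' β = 0 ∨ g β = 0) → f β = 0 ∧ a β = 0 := by
    intro β hβ h
    have hf0 : f β = 0 := by
      rcases lt_trichotomy (f β) 0 with h1 | h1 | h1
      · have := hneg β hβ h1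
        rcases h with h | h <;> linarith [this.1, this.2]
      · exact h1
      · have := hpos β hβ h1
        rcases h with h | h <;> linarith [this.1, this.2]
    rw [f'_apply, g_apply, hf0] at h
    refine ⟨hf0, ?_⟩
    rcases h with h | h <;> linarith
  have hrank : ∀ h : V →ₗ[ℝ] ℝ, (∀ β ∈ rootSystem B Δ, h β = 0 → f β = 0 ∧ a β = 0) →
      Module.finrank ℝ (Ks B Δ h) < n := by
    intro h hh
    rw [← hf]
    apply Submodule.finrank_lt_finrank_of_lt
    refine lt_of_le_of_ne (Submodule.span_mono fun β hβ => ⟨hβ.1, (hh β hβ.1 hβ.2).1⟩) ?_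
    intro heq
    have h1 : α ∈ Ks B Δ f := Submodule.subset_span ⟨hαΦ, hfα⟩
    rw [← heq] at h1
    have h2 : Ks B Δ h ≤ LinearMap.ker a :=
      Submodule.span_le.2 fun β hβ => (hh β hβ.1 hβ.2).2
    have h3 : a α = 0 := h2 h1
    rw [haα] at h3
    exact one_ne_zero h3
  have cl1 : d (Hs B Δ f') ⊆ Hs B Δ f' :=
    ih _ (hrank f' fun β hβ h => hker β hβ (Or.inl h)) f' rfl
  have cl2 : d (Hs B Δ g) ⊆ Hs B Δ g :=
    ih _ (hrank g fun β hβ h => hker β hβ (Or.inr h)) g rfl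
  set Z := Hs B Δ f' ∩ Hs B Δ g with hZ
  have hZΦ : Z ⊆ rootSystem B Δ := fun x hx => hx.1.1
  have hZα : Z ∪ {α} ⊆ Hs B Δ f' := by
    refine Set.union_subset Set.inter_subset_left (Set.singleton_subset_iff.2 ⟨hαΦ, ?_⟩)
    rw [f'_apply, hfα, haα]; norm_num
  have hnα := root_neg hb hαΦ
  have hZαα : Z ∪ {α} ∪ {-α} ⊆ rootSystem B Δ :=
    Set.union_subset (hZα.trans (hHs _)) (Set.singleton_subset_iff.2 hnα)
  -- the half space is generated by `Z`, `α` and `-α`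
  have hΔZ : ∀ γ ∈ Δ, γ ∈ Z ∪ {α} := by
    intro γ hγ
    by_cases h : γ = α
    · exact Or.inr h
    · have h1 : a γ = 0 := coord_ne hb hγ h
      have h2 := mul_nonneg hN0.le (hdom γ hγ)
      refine Or.inl ⟨⟨simple_root hγ, ?_⟩, ⟨simple_root hγ, ?_⟩⟩
      · rw [f'_apply, h1]; linarith
      · rw [g_apply, h1]; linarith
  have hgen : Hs B Δ f ⊆ cone (Z ∪ {α} ∪ {-α}) := by
    rintro β ⟨hβ, hfβ⟩
    rcases pos_or_neg hb hfin hβ with h | h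
    · exact cone_mono (fun γ hγ => Or.inl (hΔZ γ hγ)) h.2
    · have hsp := root_span h.1
      have hsum := apply_expand hb hsp f
      have hterm : ∀ γ ∈ hb.finite.toFinset, 0 ≤ coord hb γ (-β) * f γ := fun γ hγ =>
        mul_nonneg (coord_nonneg hb h.2 γ (hb.finite.mem_toFinset.1 hγ))
          (hdom γ (hb.finite.mem_toFinset.1 hγ))
      have hz : ∀ γ ∈ hb.finite.toFinset, coord hb γ (-β) * f γ = 0 := by
        refine (Finset.sum_eq_zero_iff_of_nonneg hterm).1 (le_antisymm ?_ (Finset.sum_nonneg hterm))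
        rw [← hsum, map_neg]
        linarith
      have hexp : β = ∑ γ ∈ hb.finite.toFinset with coord hb γ (-β) ≠ 0,
          coord hb γ (-β) • (-γ) := by
        have h1 := expand hb hsp
        rw [Finset.sum_filter_of_ne (p := fun γ => coord hb γ (-β) ≠ 0)
          (fun γ _ hne h0 => hne (by rw [h0, zero_smul]))]
        simp only [smul_neg, Finset.sum_neg_distrib]
        rw [← h1, neg_neg]
      rw [hexp]
      refine cone_sum _ _ _ ?_ ?_
      · intro γ hγ
        exact coord_nonneg hb h.2 γ (hb.finite.mem_toFinset.1 (Finset.mem_filter.1 hγ).1)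
      · intro γ hγ
        obtain ⟨hγD, hγ0⟩ := Finset.mem_filter.1 hγ
        have hγ := hb.finite.mem_toFinset.1 hγD
        have hfγ : f γ = 0 := (mul_eq_zero.1 (hz γ hγD)).resolve_left hγ0
        by_cases h : γ = α
        · exact Or.inr (by rw [h]; rfl)
        · have h1 : a γ = 0 := coord_ne hb hγ h
          have h2 := root_neg hb (simple_root (B := B) hγ)
          refine Or.inl (Or.inl ⟨⟨h2, ?_⟩, ⟨h2, ?_⟩⟩)
          · rw [f'_apply, map_neg, map_neg, hfγ, h1]; simp
          · rw [g_apply, map_neg, map_neg, hfγ, h1]; simp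
  intro x hx
  have hxΦ : x ∈ rootSystem B Δ := om.cx_le_ground _ (hHs f) hx
  refine ⟨hxΦ, ?_⟩
  by_contra hxn
  rw [not_le] at hxn
  obtain ⟨hxf', hxg⟩ := hneg x hxΦ hxn
  have hx2 : x ∈ d (Z ∪ {α} ∪ {-α}) := by
    have hsub : Hs B Δ f ⊆ d (Z ∪ {α} ∪ {-α}) := fun β hβ =>
      cone_sub hb hfin hd hZαα ⟨hgen hβ, hβ.1⟩
    have := om.cx_mono _ _ hsub (om.cx_le_ground _ hZαα) hx
    rwa [om.cx_idem _ hZαα] at this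
  have hx3 : x ∉ d (Z ∪ {α}) := by
    intro h
    have := (cl1 (om.cx_mono _ _ hZα (hHs f') h)).2
    linarith
  have h4 := om.exchange3 _ (hZα.trans (hHs f')) x hxΦ α hαΦ hx2 hx3
  have hsub : ((Z ∪ {α}) \ {α}) ∪ {-x} ⊆ Hs B Δ g := by
    refine Set.union_subset ?_ (Set.singleton_subset_iff.2 ⟨root_neg hb hxΦ, ?_⟩)
    · rintro y ⟨hy | hy, hne⟩
      · exact hy.2
      · exact absurd hy hne
    · rw [map_neg]; linarith
  have h5 := (cl2 (om.cx_mono _ _ hsub (hHs g) h4)).2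
  rw [g_apply, hfα, haα] at h5
  norm_num at h5

end

end OMRS

/-- a finite based root system has a unique OMRS structure:
any OMRS closure `d` coincides with the RRS closure `cone_Φ`. -/
theorem finite_unique_OMRS [FiniteDimensional ℝ V]
    (B : LinearMap.BilinForm ℝ V) (Δ : Set V)
    (hbrs : IsBasedRootSystem B Δ) (hfin : (rootSystem B Δ).Finite)
    (d : Set V → Set V) (hd : IsOMRS B Δ d) :
    ∀ X, X ⊆ rootSystem B Δ → d X = cone X ∩ rootSystem B Δ := by
  intro X hX
  refine Set.Subset.antisymm (fun x hx => ?_) (OMRS.cone_sub hbrs hfin hd hX)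
  have hxΦ := hd.om.cx_le_ground _ hX hx
  refine ⟨?_, hxΦ⟩
  by_contra hcon
  obtain ⟨f, hf, hfx⟩ := OMRS.exists_separating (hfin.subset hX) hcon
  have hsub : X ⊆ OMRS.Hs B Δ f := fun y hy => ⟨hX hy, hf y hy⟩
  have h1 := hd.om.cx_mono _ _ hsub (fun y hy => hy.1) hx
  have h2 := (OMRS.half_closed hbrs hfin hd _ f rfl h1).2
  linarith
end

section
/- Let V be a 3-dimensional real vector space and let Γ ⊆ V ∖ {0} be a countable subset with Γ = −Γ, ℝ_{>0}γ ∩ Γ = {γ} for each γ ∈ Γ, and span(Γ) = V. Let (Γ, γ ↦ −γ, d) be a reduced oriented matroid such that d(X) = cone(X) ∩ Γ whenever X ⊆ Γ spans a linear subspace of dimension at most 2. If every tope of (Γ, γ ↦ −γ, d) is also a tope of the realizable oriented matroid (Γ, γ ↦ −γ, cone_Γ), then the topes of (Γ, γ ↦ −γ, d) are exactly the topes of (Γ, γ ↦ −γ, cone_Γ). In other words, the topes of a rank 3 oriented matroid of this kind cannot form a proper subset of the topes of the realizable rank 3 oriented matroid on the same ground set. -/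
open Set Pointwise

variable {V : Type*} [AddCommGroup V] [Module ℝ V]

/-! ### Basic facts about cones -/

theorem cone_sum_mem {X : Set V} {n : ℕ} (c : Fin n → ℝ) (x : Fin n → V)
    (hc : ∀ i, 0 ≤ c i) (hx : ∀ i, x i ∈ X) : ∑ i, c i • x i ∈ cone X :=
  ⟨n, c, x, hc, hx, rfl⟩

theorem cone_zero_mem (X : Set V) : (0 : V) ∈ cone X :=
  ⟨0, Fin.elim0, Fin.elim0, fun i => i.elim0, fun i => i.elim0, by simp⟩

theorem cone_smul_mem {X : Set V} {t : ℝ} (ht : 0 ≤ t) {v : V} (hv : v ∈ cone X) :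
    t • v ∈ cone X := by
  obtain ⟨n, c, x, hc, hx, rfl⟩ := hv
  refine ⟨n, fun i => t * c i, x, fun i => mul_nonneg ht (hc i), hx, ?_⟩
  simp [Finset.smul_sum, mul_smul]

theorem cone_add_mem {X : Set V} {u v : V} (hu : u ∈ cone X) (hv : v ∈ cone X) :
    u + v ∈ cone X := by
  obtain ⟨n, c, x, hc, hx, rfl⟩ := hu
  obtain ⟨m, c', x', hc', hx', rfl⟩ := hv
  refine ⟨n + m, Fin.append c c', Fin.append x x', ?_, ?_, ?_⟩
  · intro i
    refine Fin.addCases (fun i => ?_) (fun i => ?_) i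
    · simpa using hc i
    · simpa using hc' i
  · intro i
    refine Fin.addCases (fun i => ?_) (fun i => ?_) i
    · simpa using hx i
    · simpa using hx' i
  · simp [Fin.sum_univ_add]

theorem subset_cone (X : Set V) : X ⊆ cone X := fun v hv =>
  ⟨1, fun _ => 1, fun _ => v, fun _ => zero_le_one, fun _ => hv, by simp⟩

theorem cone_mono {X Y : Set V} (h : X ⊆ Y) : cone X ⊆ cone Y := by
  rintro v ⟨n, c, x, hc, hx, rfl⟩
  exact ⟨n, c, x, hc, fun i => h (hx i), rfl⟩

theorem cone_nonneg {X : Set V} (f : V →ₗ[ℝ] ℝ) (hf : ∀ x ∈ X, 0 ≤ f x) {v : V}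
    (hv : v ∈ cone X) : 0 ≤ f v := by
  obtain ⟨n, c, x, hc, hx, rfl⟩ := hv
  rw [map_sum]
  refine Finset.sum_nonneg fun i _ => ?_
  rw [map_smul, smul_eq_mul]
  exact mul_nonneg (hc i) (hf _ (hx i))

theorem cone_pos {X : Set V} (f : V →ₗ[ℝ] ℝ) (hf : ∀ x ∈ X, 0 < f x) {v : V}
    (hv : v ∈ cone X) (hv0 : v ≠ 0) : 0 < f v := by
  refine lt_of_le_of_ne (cone_nonneg f (fun x hx => (hf x hx).le) hv) fun h => hv0 ?_
  obtain ⟨n, c, x, hc, hx, rfl⟩ := hv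
  rw [map_sum, eq_comm, Finset.sum_eq_zero_iff_of_nonneg] at h
  · refine Finset.sum_eq_zero fun i hi => ?_
    have h1 := h i hi
    rw [map_smul, smul_eq_mul, mul_eq_zero] at h1
    rcases h1 with h1 | h1
    · simp [h1]
    · exact absurd h1 (hf _ (hx i)).ne'
  · intro i _
    rw [map_smul, smul_eq_mul]
    exact mul_nonneg (hc i) (hf _ (hx i)).le

theorem span_subset_cone {S : Set V} (hS : ∀ x ∈ S, -x ∈ S) {v : V}
    (hv : v ∈ Submodule.span ℝ S) : v ∈ cone S ∧ -v ∈ cone S := by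
  induction hv using Submodule.span_induction with
  | mem x hx => exact ⟨subset_cone S hx, subset_cone S (hS x hx)⟩
  | zero => simpa using cone_zero_mem S
  | add x y _ _ hx hy =>
    refine ⟨cone_add_mem hx.1 hy.1, ?_⟩
    rw [neg_add]
    exact cone_add_mem hx.2 hy.2
  | smul t x _ hx =>
    rcases le_total 0 t with ht | ht
    · refine ⟨cone_smul_mem ht hx.1, ?_⟩
      rw [← smul_neg]
      exact cone_smul_mem ht hx.2
    · have ht' : 0 ≤ -t := by linarith
      refine ⟨?_, ?_⟩
      · have := cone_smul_mem ht' hx.2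
        simpa using this
      · have := cone_smul_mem ht' hx.1
        simpa using this

/-- Carathéodory's theorem for cones. -/
theorem cone_caratheodory {X : Set V} {v : V} (hv : v ∈ cone X) :
    ∃ (n : ℕ) (c : Fin n → ℝ) (x : Fin n → V), LinearIndependent ℝ x ∧
      (∀ i, 0 ≤ c i) ∧ (∀ i, x i ∈ X) ∧ v = ∑ i, c i • x i := by
  obtain ⟨n, h⟩ := hv
  induction n with
  | zero =>
    obtain ⟨c, x, hc, hx, hv⟩ := h
    exact ⟨0, c, x, linearIndependent_empty_type, hc, hx, hv⟩
  | succ n ih =>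
    obtain ⟨c, x, hc, hx, hv⟩ := h
    by_cases hli : LinearIndependent ℝ x
    · exact ⟨n + 1, c, x, hli, hc, hx, hv⟩
    apply ih
    obtain ⟨g, hg, hpos⟩ : ∃ g : Fin (n + 1) → ℝ, ∑ i, g i • x i = 0 ∧ ∃ i, 0 < g i := by
      rw [Fintype.not_linearIndependent_iff] at hli
      obtain ⟨g, hg, i, hi⟩ := hli
      rcases lt_or_gt_of_ne hi with h | h
      · exact ⟨-g, by simp [hg], i, by simpa using h⟩
      · exact ⟨g, hg, i, h⟩
    obtain ⟨j, hj, hmin⟩ := Finset.exists_min_image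
      (Finset.univ.filter fun i => 0 < g i) (fun i => c i / g i)
      (by obtain ⟨i, hi⟩ := hpos; exact ⟨i, by simpa using hi⟩)
    simp only [Finset.mem_filter, Finset.mem_univ, true_and] at hj hmin
    set t := c j / g j with ht
    have ht0 : 0 ≤ t := div_nonneg (hc j) hj.le
    refine ⟨fun i => c (j.succAbove i) - t * g (j.succAbove i), fun i => x (j.succAbove i),
      fun i => ?_, fun i => hx _, ?_⟩
    · by_cases hgi : 0 < g (j.succAbove i)
      · have := hmin _ hgi
        rw [le_div_iff₀ hgi] at this
        simpa using this
      · have := hc (j.succAbove i)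
        nlinarith
    · have h1 : v = ∑ i, (c i - t * g i) • x i := by
        simp only [sub_smul, mul_smul, Finset.sum_sub_distrib, ← Finset.smul_sum, hg, hv]
        simp
      rw [h1, Fin.sum_univ_succAbove _ j]
      have : c j - t * g j = 0 := by
        rw [ht]; field_simp; ring
      rw [this]; simp

/-- Farkas' lemma for finite families. -/
theorem farkas_family (n : ℕ) : ∀ (x : Fin n → V) (v : V),
    (∃ c : Fin n → ℝ, (∀ i, 0 ≤ c i) ∧ v = ∑ i, c i • x i) ∨
    ∃ f : V →ₗ[ℝ] ℝ, (∀ i, 0 ≤ f (x i)) ∧ f v < 0 := by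
  induction n with
  | zero =>
    intro x v
    by_cases hv : v = 0
    · left; exact ⟨fun _ => 0, fun _ => le_rfl, by simp [hv]⟩
    · right
      obtain ⟨f, hf⟩ := (show ∃ f : V →ₗ[ℝ] ℝ, f v ≠ 0 by
        by_contra! h
        exact hv ((Module.forall_dual_apply_eq_zero_iff ℝ v).mp h))
      rcases lt_or_gt_of_ne hf with h | h
      · exact ⟨f, fun i => i.elim0, h⟩
      · exact ⟨-f, fun i => i.elim0, by simpa using h⟩
  | succ n ih =>
    intro x v
    set a := x 0 with ha
    rcases ih (fun i => x i.succ) v with ⟨c, hc, hv⟩ | ⟨f, hf, hfv⟩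
    · left
      refine ⟨Fin.cons 0 c, ?_, ?_⟩
      · intro i
        refine Fin.cases ?_ (fun i => ?_) i
        · simp
        · simpa using hc i
      · simp [Fin.sum_univ_succ, hv]
    by_cases hfa : 0 ≤ f a
    · right
      refine ⟨f, ?_, hfv⟩
      intro i
      refine Fin.cases hfa (fun i => hf i) i
    push Not at hfa
    let p : V →ₗ[ℝ] V := LinearMap.id - (((f a)⁻¹ • f).smulRight a)
    have hp : ∀ w, p w = w - ((f a)⁻¹ * f w) • a := fun w => by simp [p]
    rcases ih (fun i => p (x i.succ)) (p v) with ⟨c, hc, hv⟩ | ⟨g, hg, hgv⟩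
    · left
      have hinv : (f a)⁻¹ < 0 := inv_lt_zero.mpr hfa
      refine ⟨Fin.cons ((f a)⁻¹ * f v - ∑ i, c i * ((f a)⁻¹ * f (x i.succ))) c, ?_, ?_⟩
      · intro i
        refine Fin.cases ?_ (fun i => ?_) i
        · have h1 : 0 ≤ (f a)⁻¹ * f v := by nlinarith
          have h2 : ∑ i, c i * ((f a)⁻¹ * f (x i.succ)) ≤ 0 := by
            refine Finset.sum_nonpos fun i _ => ?_
            exact mul_nonpos_of_nonneg_of_nonpos (hc i)
              (mul_nonpos_of_nonpos_of_nonneg hinv.le (hf i))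
          simp only [Fin.cons_zero]
          linarith
        · simpa using hc i
      · simp only [hp, smul_sub, Finset.sum_sub_distrib, smul_smul, ← Finset.sum_smul] at hv
        rw [Fin.sum_univ_succ]
        simp only [Fin.cons_zero, Fin.cons_succ, ← ha, sub_smul]
        rw [sub_eq_iff_eq_add] at hv
        refine hv.trans ?_
        abel
    · right
      refine ⟨g ∘ₗ p, ?_, by simpa using hgv⟩
      intro i
      refine Fin.cases ?_ (fun i => by simpa using hg i) i
      have : p (x 0) = 0 := by
        rw [hp, ← ha, inv_mul_cancel₀ hfa.ne]; simp
      simp [this]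

theorem farkas_finite {Y : Set V} (hY : Y.Finite) {v : V} (hv : v ∉ cone Y) :
    ∃ f : V →ₗ[ℝ] ℝ, (∀ y ∈ Y, 0 ≤ f y) ∧ f v < 0 := by
  obtain ⟨n, x, _, hx⟩ := hY.fin_param
  rcases farkas_family n x v with ⟨c, hc, h⟩ | ⟨f, hf, hfv⟩
  · exact absurd ⟨n, c, x, hc, fun i => hx ▸ mem_range_self i, h⟩ hv
  · refine ⟨f, ?_, hfv⟩
    rw [← hx]
    rintro _ ⟨i, rfl⟩
    exact hf i

theorem finrank_ker_eq_two [FiniteDimensional ℝ V] (hdim : Module.finrank ℝ V = 3)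
    {f : V →ₗ[ℝ] ℝ} {v : V} (hv : f v ≠ 0) : Module.finrank ℝ (LinearMap.ker f) = 2 := by
  have h1 := LinearMap.finrank_range_add_finrank_ker f
  have h2 : LinearMap.range f = ⊤ := LinearMap.range_eq_top.mpr
    (LinearMap.surjective (f := f) (by rintro rfl; simp at hv))
  rw [h2, finrank_top, hdim] at h1
  simp at h1
  omega

/-- A finite spanning set and a point outside its cone are separated by a hyperplane which is
spanned by elements of the set. -/
theorem facet_separation [FiniteDimensional ℝ V] (hdim : Module.finrank ℝ V = 3)
    {Y : Set V} (hY : Y.Finite) (hspan : Submodule.span ℝ Y = ⊤) {v : V} (k : ℕ) :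
    ∀ f : V →ₗ[ℝ] ℝ, (∀ y ∈ Y, 0 ≤ f y) → f v < 0 → {y ∈ Y | f y ≠ 0}.ncard ≤ k →
    ∃ f : V →ₗ[ℝ] ℝ, (∀ y ∈ Y, 0 ≤ f y) ∧ f v < 0 ∧
      Submodule.span ℝ {y ∈ Y | f y = 0} = LinearMap.ker f := by
  induction k with
  | zero =>
    intro f hf hfv hk
    exfalso
    have hfin : {y ∈ Y | f y ≠ 0}.Finite := hY.subset (sep_subset _ _)
    have h1 : {y ∈ Y | f y ≠ 0} = ∅ := by
      rw [← Set.ncard_eq_zero hfin]; omega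
    have h2 : Submodule.span ℝ Y ≤ LinearMap.ker f := by
      rw [Submodule.span_le]
      intro y hy
      by_contra h
      have : y ∈ {y ∈ Y | f y ≠ 0} := ⟨hy, h⟩
      rw [h1] at this
      exact this
    rw [hspan] at h2
    have := h2 (Submodule.mem_top (x := v))
    rw [LinearMap.mem_ker] at this
    linarith
  | succ k ih =>
    intro f hf hfv hk
    by_cases hS : Submodule.span ℝ {y ∈ Y | f y = 0} = LinearMap.ker f
    · exact ⟨f, hf, hfv, hS⟩
    set S := Submodule.span ℝ {y ∈ Y | f y = 0} with hSdef
    have hle : S ≤ LinearMap.ker f := by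
      rw [hSdef, Submodule.span_le]
      intro y hy
      exact hy.2
    have hlt : S < LinearMap.ker f := lt_of_le_of_ne hle hS
    have hr := Submodule.finrank_lt_finrank_of_lt hlt
    rw [finrank_ker_eq_two hdim hfv.ne] at hr
    have hT : S ⊔ Submodule.span ℝ {v} < ⊤ := by
      rw [lt_top_iff_ne_top]
      intro h
      have h1 := Submodule.finrank_add_le_finrank_add_finrank S (Submodule.span ℝ {v})
      rw [h, finrank_top, hdim] at h1
      have h2 := finrank_span_le_card (R := ℝ) ({v} : Set V)
      simp at h2
      omega
    obtain ⟨g, hg0, hgT⟩ := Submodule.exists_le_ker_of_lt_top _ hT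
    have hgS : ∀ y ∈ Y, f y = 0 → g y = 0 := fun y hy hfy =>
      hgT (Submodule.mem_sup_left (Submodule.subset_span ⟨hy, hfy⟩))
    have hgv : g v = 0 :=
      hgT (Submodule.mem_sup_right (Submodule.mem_span_singleton_self v))
    obtain ⟨y, hy, hgy⟩ : ∃ y ∈ Y, g y ≠ 0 := by
      by_contra! h
      apply hg0
      refine LinearMap.ker_eq_top.mp ?_
      rw [eq_top_iff, ← hspan, Submodule.span_le]
      exact fun y hy => h y hy
    obtain ⟨g, hgS, hgv, hgy⟩ : ∃ g : V →ₗ[ℝ] ℝ, (∀ y ∈ Y, f y = 0 → g y = 0) ∧ g v = 0 ∧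
        g y < 0 := by
      rcases lt_or_gt_of_ne hgy with h | h
      · exact ⟨g, hgS, hgv, h⟩
      · refine ⟨-g, fun y hy hfy => by simp [hgS y hy hfy], by simp [hgv], by simpa using h⟩
    obtain ⟨z, ⟨hzY, hz⟩, hmin⟩ := Set.exists_min_image {y ∈ Y | g y < 0}
      (fun y => f y / (-g y)) (hY.subset (sep_subset _ _)) ⟨y, hy, hgy⟩
    set t := f z / (-g z) with ht
    have ht0 : 0 ≤ t := div_nonneg (hf z hzY) (by linarith)
    have hfz : f z ≠ 0 := fun h => hz.ne (hgS z hzY h)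
    refine ih (f + t • g) ?_ ?_ ?_
    · intro w hw
      simp only [LinearMap.add_apply, LinearMap.smul_apply, smul_eq_mul]
      rcases lt_or_ge (g w) 0 with h | h
      · have := hmin w ⟨hw, h⟩
        rw [le_div_iff₀ (by linarith)] at this
        linarith
      · have := hf w hw
        positivity
    · simpa [hgv] using hfv
    · have hss : {y ∈ Y | (f + t • g) y ≠ 0} ⊂ {y ∈ Y | f y ≠ 0} := by
        refine ⟨?_, ?_⟩
        · rintro w ⟨hw, h⟩
          refine ⟨hw, fun h' => h ?_⟩
          simp [h', hgS w hw h']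
        · intro h
          have := (h ⟨hzY, hfz⟩).2
          apply this
          simp only [LinearMap.add_apply, LinearMap.smul_apply, smul_eq_mul, ht]
          have := hz.ne
          field_simp
          ring
      have := Set.ncard_lt_ncard hss (hY.subset (sep_subset _ _))
      omega

/-! ### Oriented matroid facts -/

/-- Adding `-x` to a closed asymmetric set not containing `x` keeps the closure asymmetric. -/
theorem asymm_extend {E : Set V} {d : Set V → Set V} (hom : IsOrientedMatroidOn E d)
    {Y : Set V} (hYE : Y ⊆ E) (hYc : d Y ⊆ Y) (hYa : ∀ z ∈ Y, -z ∉ Y) {x : V} (hx : x ∈ E)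
    (hxY : x ∉ Y) : ∀ z ∈ d (Y ∪ {-x}), -z ∉ d (Y ∪ {-x}) := by
  intro z hz hnz
  have hUE : Y ∪ {-x} ⊆ E := union_subset hYE (by simpa using hom.neg_mem x hx)
  have hzE : z ∈ E := hom.cx_le_ground _ hUE hz
  have hnzE : -z ∈ E := hom.neg_mem z hzE
  -- the key step, applied to `z` or to `-z`
  have key : ∀ w ∈ E, w ∈ d (Y ∪ {-x}) → -w ∈ d (Y ∪ {-x}) → -w ∉ Y → False := by
    intro w hwE hw hnw hnwY
    have h1 := hom.exchange3 Y hYE (-w) (hom.neg_mem w hwE) x hx hnw (fun h => hnwY (hYc h))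
    rw [neg_neg] at h1
    have h2 : x ∈ d (d (Y ∪ {-x})) := by
      refine hom.cx_mono _ _ ?_ (hom.cx_le_ground _ hUE) h1
      refine union_subset ?_ (by simpa using hw)
      exact sdiff_subset.trans (subset_union_left.trans (hom.le_cx _ hUE))
    rw [hom.cx_idem _ hUE] at h2
    exact hxY (hYc (hom.exchange2 Y hYE x hx h2))
  by_cases h : -z ∈ Y
  · refine key (-z) hnzE hnz (by simpa using hz) ?_
    exact hYa _ h
  · exact key z hzE hz hnz h

/-- Every set with asymmetric closure is contained in a tope. -/
theorem exists_tope {E : Set V} {d : Set V → Set V} (hom : IsOrientedMatroidOn E d)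
    {X : Set V} (hXE : X ⊆ E) (hXa : ∀ z ∈ d X, -z ∉ d X) :
    ∃ R, IsTope E d R ∧ X ⊆ R := by
  obtain ⟨R, hXR, hR⟩ := zorn_subset_nonempty
    {R : Set V | R ⊆ E ∧ d R ⊆ R ∧ ∀ x ∈ R, -x ∉ R} (by
      intro c hc hchain hne
      have hUE : ⋃₀ c ⊆ E := sUnion_subset fun s hs => (hc hs).1
      refine ⟨⋃₀ c, ⟨hUE, ?_, ?_⟩, fun s hs => subset_sUnion_of_mem hs⟩
      · intro x hx
        obtain ⟨Y, hY, hYfin, hxY⟩ := hom.finitary _ hUE x hx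
        obtain ⟨s, hs, hYs⟩ := DirectedOn.exists_mem_subset_of_finite_of_subset_sUnion hne
          hchain.directedOn hYfin hY
        exact ⟨s, hs, (hc hs).2.1 (hom.cx_mono _ _ hYs (hc hs).1 hxY)⟩
      · rintro x ⟨s, hs, hxs⟩ ⟨s', hs', hxs'⟩
        rcases hchain.total hs hs' with h | h
        · exact (hc hs').2.2 x (h hxs) hxs'
        · exact (hc hs).2.2 x hxs (h hxs'))
    (d X) ⟨hom.cx_le_ground X hXE, (hom.cx_idem X hXE).subset, hXa⟩
  refine ⟨R, ⟨hR.prop.1, hR.prop.2.1, hR.prop.2.2, ?_⟩, (hom.le_cx X hXE).trans hXR⟩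
  intro R' h1 h2 h3 h4
  exact (hR.eq_of_subset ⟨h1, h2, h3⟩ h4).symm

/-- If all `d`-topes are realizable topes, then `d` contains the cone closure on sets with
asymmetric closure. -/
theorem cone_subset_of_asymm {E : Set V} {d : Set V → Set V} (hom : IsOrientedMatroidOn E d)
    (hsub : ∀ R : Set V, IsTope E d R → IsTope E (fun X => cone X ∩ E) R)
    {X : Set V} (hXE : X ⊆ E) (hXa : ∀ z ∈ d X, -z ∉ d X) : cone X ∩ E ⊆ d X := by
  rintro x ⟨hx, hxE⟩
  by_contra hxd
  have hdE := hom.cx_le_ground X hXE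
  have h1 := asymm_extend hom hdE (hom.cx_idem X hXE).subset hXa hxE hxd
  have hUE : d X ∪ {-x} ⊆ E := union_subset hdE (by simpa using hom.neg_mem x hxE)
  obtain ⟨R, hR, hXR⟩ := exists_tope hom hUE h1
  have hR' := hsub R hR
  have h2 : x ∈ R := hR'.2.1 ⟨cone_mono ((hom.le_cx X hXE).trans
    (subset_union_left.trans hXR)) hx, hxE⟩
  exact hR'.2.2.1 x h2 (hXR (Or.inr rfl))

section main

variable {Γ : Set V} {d : Set V → Set V}

/-- The cone closure is contained in `d`. -/
theorem cone_subset_d [FiniteDimensional ℝ V]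
    (hdim : Module.finrank ℝ V = 3) (hom : IsOrientedMatroidOn Γ d)
    (hrank2 : ∀ X, X ⊆ Γ → Module.rank ℝ ↥(Submodule.span ℝ X) ≤ 2 → d X = cone X ∩ Γ)
    (hsub : ∀ R : Set V, IsTope Γ d R → IsTope Γ (fun X => cone X ∩ Γ) R)
    {X : Set V} (hX : X ⊆ Γ) : cone X ∩ Γ ⊆ d X := by
  rintro v ⟨hv, hvΓ⟩
  obtain ⟨n, c, x, hli, hc, hx, hvs⟩ := cone_caratheodory hv
  have hrX : range x ⊆ X := by rintro _ ⟨i, rfl⟩; exact hx i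
  have hvr : v ∈ cone (range x) := ⟨n, c, x, hc, fun i => mem_range_self i, hvs⟩
  have hn : n ≤ 3 := by
    have := hli.fintype_card_le_finrank
    simpa [hdim] using this
  have hrank : ∀ {k : ℕ} (y : Fin k → V), k ≤ 2 →
      Module.rank ℝ ↥(Submodule.span ℝ (range y)) ≤ 2 := by
    intro k y hk
    rw [← Module.finrank_eq_rank]
    have := finrank_range_le_card (R := ℝ) y
    rw [Set.finrank, Fintype.card_fin] at this
    exact_mod_cast this.trans hk
  refine hom.cx_mono _ _ hrX hX ?_
  rcases Nat.lt_or_ge n 3 with h | h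
  · rw [hrank2 _ (hrX.trans hX) (hrank x (by omega))]
    exact ⟨hvr, hvΓ⟩
  obtain rfl : n = 3 := le_antisymm hn h
  refine cone_subset_of_asymm hom hsub (hrX.trans hX) ?_ ⟨hvr, hvΓ⟩
  set y : Fin 2 → V := fun i => x i.castSucc with hy
  have hyΓ : range y ⊆ Γ := by rintro _ ⟨i, rfl⟩; exact hX (hx _)
  have hdy : d (range y) = cone (range y) ∩ Γ := hrank2 _ hyΓ (hrank y le_rfl)
  -- a functional which is positive on all the `x i`
  obtain ⟨f, hf⟩ : ∃ f : V →ₗ[ℝ] ℝ, ∀ i, f (x i) = 1 := by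
    refine ⟨(Module.Basis.extend hli.linearIndepOn_id).constr ℝ (fun _ => (1 : ℝ)), fun i => ?_⟩
    have hmem := hli.linearIndepOn_id.subset_extend (subset_univ _) (mem_range_self i)
    have := (Module.Basis.extend hli.linearIndepOn_id).constr_basis ℝ (fun _ => (1 : ℝ))
      ⟨x i, hmem⟩
    rwa [Module.Basis.extend_apply_self] at this
  have hx2 : -x 2 ∉ d (range y) := by
    rw [hdy]
    rintro ⟨h, -⟩
    have := cone_nonneg f (by rintro _ ⟨i, rfl⟩; simp [hy, hf]) h
    rw [map_neg, hf] at this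
    linarith
  have hasym : ∀ z ∈ d (range y), -z ∉ d (range y) := by
    rw [hdy]
    rintro z ⟨h, hzΓ⟩ ⟨h', -⟩
    have hzpos := cone_pos f (by rintro _ ⟨i, rfl⟩; simp [hy, hf]) h
      (fun h0 => hom.neg_ne z hzΓ (by simp [h0]))
    have hznn := cone_nonneg f (by rintro _ ⟨i, rfl⟩; simp [hy, hf]) h'
    rw [map_neg] at hznn
    linarith
  have h1 := asymm_extend hom (hom.cx_le_ground _ hyΓ) (hom.cx_idem _ hyΓ).subset hasym
    (hom.neg_mem _ (hX (hx 2))) hx2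
  rw [neg_neg] at h1
  have hUE : d (range y) ∪ {x 2} ⊆ Γ := 
    union_subset (hom.cx_le_ground _ hyΓ) (by simpa using hX (hx 2))
  have hle : d (range x) ⊆ d (d (range y) ∪ {x 2}) := by
    refine hom.cx_mono _ _ ?_ hUE
    rintro _ ⟨i, rfl⟩
    refine Fin.lastCases ?_ (fun i => ?_) i
    · exact Or.inr rfl
    · exact Or.inl (hom.le_cx _ hyΓ ⟨i, rfl⟩)
  exact fun z hz hnz => h1 z (hle hz) (hle hnz)

/-- Half spaces whose boundary is spanned by elements of `Γ` are `d`-closed. -/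
theorem halfspace_closed [FiniteDimensional ℝ V]
    (hdim : Module.finrank ℝ V = 3) (hom : IsOrientedMatroidOn Γ d)
    (hrank2 : ∀ X, X ⊆ Γ → Module.rank ℝ ↥(Submodule.span ℝ X) ≤ 2 → d X = cone X ∩ Γ)
    (hcone : ∀ X, X ⊆ Γ → cone X ∩ Γ ⊆ d X) (f : V →ₗ[ℝ] ℝ)
    (hf : Submodule.span ℝ {v ∈ Γ | f v = 0} = LinearMap.ker f) {x : V}
    (hx : x ∈ d {v ∈ Γ | 0 ≤ f v}) : 0 ≤ f x := by
  by_contra! hfx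
  set Z := {v ∈ Γ | f v = 0} with hZ
  have hZΓ : Z ⊆ Γ := sep_subset _ _
  have hxΓ : x ∈ Γ := hom.cx_le_ground _ (sep_subset _ _) hx
  set y := -x with hy
  have hyΓ : y ∈ Γ := hom.neg_mem x hxΓ
  have hfy : 0 < f y := by simpa [hy] using hfx
  have hZneg : ∀ z ∈ Z, -z ∈ Z := fun z hz =>
    ⟨hom.neg_mem z hz.1, by simp [hz.2]⟩
  have hdZ : d Z = cone Z ∩ Γ := by
    refine hrank2 Z hZΓ ?_
    rw [hf, ← Module.finrank_eq_rank, finrank_ker_eq_two hdim hfy.ne']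
    simp
  have hUΓ : Z ∪ {y} ⊆ Γ := union_subset hZΓ (by simpa using hyΓ)
  have hsubset : {v ∈ Γ | 0 ≤ f v} ⊆ d (Z ∪ {y}) := by
    rintro v ⟨hvΓ, hfv⟩
    refine hcone _ hUΓ ⟨?_, hvΓ⟩
    have h1 : v - (f v / f y) • y ∈ Submodule.span ℝ Z := by
      rw [hf, LinearMap.mem_ker]
      simp only [map_sub, map_smul, smul_eq_mul]
      field_simp
      ring
    have h2 := cone_mono (subset_union_left (t := {y})) (span_subset_cone hZneg h1).1
    have h3 : (f v / f y) • y ∈ cone (Z ∪ {y}) :=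
      cone_smul_mem (div_nonneg hfv hfy.le) (subset_cone _ (Or.inr rfl))
    simpa using cone_add_mem h2 h3
  have h4 := hom.cx_mono _ _ hsubset (hom.cx_le_ground _ hUΓ) hx
  rw [hom.cx_idem _ hUΓ] at h4
  have h5 := hom.exchange2 Z hZΓ x hxΓ h4
  rw [hdZ] at h5
  have h6 := cone_nonneg f (fun z hz => hz.2.ge) h5.1
  linarith

/-- The closure operator is the cone closure. -/
theorem d_eq_cone [FiniteDimensional ℝ V]
    (hdim : Module.finrank ℝ V = 3) (hom : IsOrientedMatroidOn Γ d)
    (hrank2 : ∀ X, X ⊆ Γ → Module.rank ℝ ↥(Submodule.span ℝ X) ≤ 2 → d X = cone X ∩ Γ)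
    (hsub : ∀ R : Set V, IsTope Γ d R → IsTope Γ (fun X => cone X ∩ Γ) R)
    {X : Set V} (hX : X ⊆ Γ) : d X = cone X ∩ Γ := by
  have hcone : ∀ X, X ⊆ Γ → cone X ∩ Γ ⊆ d X := fun X hX =>
    cone_subset_d hdim hom hrank2 hsub hX
  refine Subset.antisymm (fun x hx => ?_) (hcone X hX)
  refine ⟨?_, hom.cx_le_ground X hX hx⟩
  obtain ⟨Y, hYX, hYfin, hxY⟩ := hom.finitary X hX x hx
  have hYΓ := hYX.trans hX
  refine cone_mono hYX ?_
  by_cases hr : Module.rank ℝ ↥(Submodule.span ℝ Y) ≤ 2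
  · rw [hrank2 Y hYΓ hr] at hxY
    exact hxY.1
  have hspan : Submodule.span ℝ Y = ⊤ := by
    apply Submodule.eq_top_of_finrank_eq
    rw [hdim]
    have h1 := Submodule.finrank_le (Submodule.span ℝ Y)
    rw [← Module.finrank_eq_rank] at hr
    have h2 : ¬ (Module.finrank ℝ ↥(Submodule.span ℝ Y) ≤ 2) := fun h => hr (by exact_mod_cast h)
    omega
  by_contra hxc
  obtain ⟨f0, hf0, hf0x⟩ := farkas_finite hYfin hxc
  obtain ⟨f, hf, hfx, hfs⟩ := facet_separation hdim hYfin hspan _ f0 hf0 hf0x le_rfl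
  have hker : Submodule.span ℝ {v ∈ Γ | f v = 0} = LinearMap.ker f := by
    apply le_antisymm
    · rw [Submodule.span_le]
      exact fun v hv => hv.2
    · rw [← hfs]
      exact Submodule.span_mono fun v hv => ⟨hYΓ hv.1, hv.2⟩
  have := halfspace_closed hdim hom hrank2 hcone f hker
    (hom.cx_mono Y {v ∈ Γ | 0 ≤ f v} (fun v hv => ⟨hYΓ hv, hf v hv⟩) (sep_subset _ _) hxY)
  linarith

end main

/-- the topes of a rank 3 oriented matroid restricting to the convex
closure in rank ≤ 2 cannot form a proper subset of the topes of the realizable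
oriented matroid `(Γ, -, cone_Γ)` on the same ground set. -/
theorem rank3_topes_cannot_be_proper_subset [FiniteDimensional ℝ V]
    (hdim : Module.finrank ℝ V = 3)
    (Γ : Set V) (h0 : (0 : V) ∉ Γ) (hcount : Γ.Countable) (hneg : -Γ = Γ)
    (hray : ∀ γ ∈ Γ, {v : V | ∃ t : ℝ, 0 < t ∧ v = t • γ} ∩ Γ = {γ})
    (hspan : Submodule.span ℝ Γ = ⊤)
    (d : Set V → Set V)
    (hom : IsOrientedMatroidOn Γ d) (hred : IsReducedOn Γ d)
    (hrank2 : ∀ X, X ⊆ Γ → Module.rank ℝ ↥(Submodule.span ℝ X) ≤ 2 →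
      d X = cone X ∩ Γ)
    (hsub : ∀ R : Set V, IsTope Γ d R → IsTope Γ (fun X => cone X ∩ Γ) R) :
    ∀ R : Set V, IsTope Γ d R ↔ IsTope Γ (fun X => cone X ∩ Γ) R := by
  intro R
  have h : ∀ X, X ⊆ Γ → d X = cone X ∩ Γ := fun X hX =>
    d_eq_cone hdim hom hrank2 hsub hX
  refine ⟨hsub R, ?_⟩
  rintro ⟨h1, h2, h3, h4⟩
  refine ⟨h1, (h R h1).subset.trans h2, h3, fun R' g1 g2 g3 g4 => h4 R' g1 ?_ g3 g4⟩
  exact (h R' g1).symm.subset.trans g2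
end

section
/- Let V be a finite-dimensional real vector space, let α₁, …, αₙ ∈ V* be nonzero and pairwise non-proportional linear functionals, let ε ∈ {+1, −1}ⁿ, and suppose the region R = {v ∈ V : εᵢ αᵢ(v) > 0 for all i} is nonempty. Say that ker αᵢ is a wall of R if closure(R) ∩ ker αᵢ spans ker αᵢ (equivalently, has dimension dim V − 1). If i, j, k are three distinct indices with αₖ ∈ span(αᵢ, αⱼ), then ker αᵢ, ker αⱼ, ker αₖ are not all walls of R. Consequently, the normals of any three distinct walls of a region of a central hyperplane arrangement are linearly independent. -/
/-- `ker f` is a wall of the region `R` if `closure R ∩ ker f` spans `ker f`. -/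
def IsWallOf {V : Type*} [NormedAddCommGroup V] [NormedSpace ℝ V]
    (R : Set V) (f : Module.Dual ℝ V) : Prop :=
  Submodule.span ℝ (closure R ∩ (LinearMap.ker f : Set V)) = LinearMap.ker f

theorem wall_aux
    {V : Type*} [NormedAddCommGroup V] [NormedSpace ℝ V] [FiniteDimensional ℝ V]
    {n : ℕ} (α : Fin n → Module.Dual ℝ V)
    (hprop : ∀ i j, i ≠ j → ∀ t : ℝ, α i ≠ t • α j)
    (ε : Fin n → ℝ) (hε : ∀ i, ε i = 1 ∨ ε i = -1)
    (R : Set V) (hR : R = {v : V | ∀ i, 0 < ε i * α i v})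
    (x y z : Fin n) (hyx : y ≠ x) (c d : ℝ) (hc : 0 < c) (hd : 0 < d)
    (h : ∀ v, ε x * α x v = c * (ε y * α y v) + d * (ε z * α z v))
    (hw : IsWallOf R (α x)) : False := by
  have hcl : ∀ m, ∀ v ∈ closure R, 0 ≤ ε m * α m v := by
    intro m v hv
    have hcont : Continuous (fun v => ε m * α m v) :=
      continuous_const.mul (LinearMap.continuous_of_finiteDimensional (α m))
    have hclosed : IsClosed {v : V | 0 ≤ ε m * α m v} := isClosed_le continuous_const hcont
    refine closure_minimal ?_ hclosed hv
    intro w hw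
    rw [hR] at hw
    exact (hw m).le
  have hle : LinearMap.ker (α x) ≤ LinearMap.ker (α y) := by
    unfold IsWallOf at hw
    rw [← hw, Submodule.span_le]
    rintro v ⟨hv, hvx⟩
    have hvx' : α x v = 0 := hvx
    have h1 := h v
    have h2 := hcl y v hv
    have h3 := hcl z v hv
    rw [hvx', mul_zero] at h1
    have h4 := mul_nonneg hd.le h3
    have h5 : ε y * α y v = 0 := by
      by_contra hne
      have := mul_pos hc (lt_of_le_of_ne h2 (Ne.symm hne))
      linarith
    change α y v = 0
    rcases hε y with e | e <;> rw [e] at h5 <;> linarith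
  have hex : α y ∈ Submodule.span ℝ ({α x} : Set (Module.Dual ℝ V)) := by
    have := mem_span_of_iInf_ker_le_ker (L := fun _ : Unit => α x) (K := α y) (by simpa using hle)
    simpa using this
  obtain ⟨t, ht⟩ := Submodule.mem_span_singleton.1 hex
  exact hprop y x hyx t ht.symm

/-- if `α k ∈ span(α i, α j)` for three distinct indices, then the three
hyperplanes `ker (α i)`, `ker (α j)`, `ker (α k)` are not all walls of a region `R`;
i.e. the normals of any three distinct walls of a region are linearly independent. -/
theorem three_walls_linearly_independent
    {V : Type*} [NormedAddCommGroup V] [NormedSpace ℝ V] [FiniteDimensional ℝ V]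
    {n : ℕ} (α : Fin n → Module.Dual ℝ V) (hα : ∀ i, α i ≠ 0)
    (hprop : ∀ i j, i ≠ j → ∀ t : ℝ, α i ≠ t • α j)
    (ε : Fin n → ℝ) (hε : ∀ i, ε i = 1 ∨ ε i = -1)
    (R : Set V) (hR : R = {v : V | ∀ i, 0 < ε i * α i v}) (hne : R.Nonempty)
    (i j k : Fin n) (hij : i ≠ j) (hik : i ≠ k) (hjk : j ≠ k)
    (hk : α k ∈ Submodule.span ℝ ({α i, α j} : Set (Module.Dual ℝ V))) :
    ¬ (IsWallOf R (α i) ∧ IsWallOf R (α j) ∧ IsWallOf R (α k)) := by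
  rintro ⟨wi, wj, wk⟩
  obtain ⟨a, b, hab⟩ := Submodule.mem_span_pair.1 hk
  have ha : a ≠ 0 := by
    rintro rfl
    exact hprop k j hjk.symm b (by rw [← hab]; simp)
  have hb : b ≠ 0 := by
    rintro rfl
    exact hprop k i hik.symm a (by rw [← hab]; simp)
  have hsq : ∀ m, ε m * ε m = 1 := by
    intro m
    rcases hε m with e | e <;> rw [e] <;> norm_num
  have hs : ∀ m, ε m ≠ 0 := by
    intro m e
    have := hsq m
    rw [e] at this
    norm_num at this
  obtain ⟨p, hp⟩ : ∃ p, p = ε k * a * ε i := ⟨_, rfl⟩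
  obtain ⟨q, hq⟩ : ∃ q, q = ε k * b * ε j := ⟨_, rfl⟩
  have hp0 : p ≠ 0 := by
    rw [hp]; exact mul_ne_zero (mul_ne_zero (hs k) ha) (hs i)
  have hq0 : q ≠ 0 := by
    rw [hq]; exact mul_ne_zero (mul_ne_zero (hs k) hb) (hs j)
  have key : ∀ v, ε k * α k v = p * (ε i * α i v) + q * (ε j * α j v) := by
    intro v
    rw [← hab, hp, hq]
    simp only [LinearMap.add_apply, LinearMap.smul_apply, smul_eq_mul]
    linear_combination (-(ε k * a * α i v)) * hsq i - (ε k * b * α j v) * hsq j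
  rcases lt_or_gt_of_ne hp0 with hpn | hpp
  · rcases lt_or_gt_of_ne hq0 with hqn | hqp
    · obtain ⟨v, hv⟩ := hne
      rw [hR] at hv
      have h1 := key v
      have h2 := mul_neg_of_neg_of_pos hpn (hv i)
      have h3 := mul_neg_of_neg_of_pos hqn (hv j)
      have h4 := hv k
      linarith
    · refine wall_aux α hprop ε hε R hR j k i hjk.symm (1 / q) (-p / q)
        (by positivity) (div_pos (by linarith) hqp) ?_ wj
      intro v
      rw [key v]
      field_simp
      ring
  · rcases lt_or_gt_of_ne hq0 with hqn | hqp
    · refine wall_aux α hprop ε hε R hR i k j hik.symm (1 / p) (-q / p)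
        (by positivity) (div_pos (by linarith) hpp) ?_ wi
      intro v
      rw [key v]
      field_simp
      ring
    · exact wall_aux α hprop ε hε R hR k i j hik p q hpp hqp key wk
end
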